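/- arXiv:0801.1904 — 5 statements merged into one kernel-verified Lean document; each statement's English description precedes it below -/
import Mathlib

section
/- Let X be a completely regular Hausdorff space, Y a paracompact Hausdorff C-space, and f : X → Y an open continuous surjection such that for every y ∈ Y the fiber f⁻¹(y) is infinite and C*-embedded in X. Then f has the Bula property: there exist two disjoint closed subsets F₀, F₁ ⊂ X with f(F₀) = Y = f(F₁). -/
open Set Topology Filter

/-- A topological space `Y` is a C-space if for every sequence of open covers `W n`
there is a sequence `V n` of pairwise disjoint open families such that each `V n`
refines `W n` and the union of all `V n` is a cover. -/
def IsCSpace (Y : Type*) [TopologicalSpace Y] : Prop :=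
  ∀ W : ℕ → Set (Set Y),
    (∀ n, (∀ U ∈ W n, IsOpen U) ∧ ⋃₀ W n = Set.univ) →
    ∃ V : ℕ → Set (Set Y),
      (∀ n, (∀ U ∈ V n, IsOpen U) ∧ (V n).Pairwise Disjoint ∧
        ∀ U ∈ V n, ∃ W' ∈ W n, U ⊆ W') ∧
      ⋃₀ (⋃ n, V n) = Set.univ

/-- A subset `A ⊆ X` is C*-embedded if every bounded continuous real-valued
function on `A` extends continuously to `X`. -/
def CStarEmbedded {X : Type*} [TopologicalSpace X] (A : Set X) : Prop :=
  ∀ g : C(A, ℝ), (∃ M : ℝ, ∀ a : A, |g a| ≤ M) →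
    ∃ G : C(X, ℝ), ∀ a : A, G a = g a


/-- `h 0, …, h (n-1)` are linearly independent modulo constants on the fiber over `y`. -/
def FibInd {X Y : Type*} [TopologicalSpace X] (f : X → Y) (n : ℕ) (y : Y) (h : ℕ → C(X, ℝ)) : Prop :=
  ∀ c : ℕ → ℝ, (∀ x x', f x = y → f x' = y →
    ∑ i ∈ Finset.range n, c i * h i x = ∑ i ∈ Finset.range n, c i * h i x') →
    ∀ i < n, c i = 0

lemma open_lift {X Y C : Type*} [TopologicalSpace X] [TopologicalSpace Y] [TopologicalSpace C]
    {f : X → Y} (hopen : IsOpenMap f) {Q : X → C → Prop} {x : X} {c : C}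
    (hQ : ∀ᶠ z in 𝓝 (x, c), Q z.1 z.2) :
    ∀ᶠ z in 𝓝 (f x, c), ∃ x₁, f x₁ = z.1 ∧ Q x₁ z.2 := by
  have h := (hopen.prodMap (IsOpenMap.id (X := C))).image_mem_nhds (x := (x, c)) hQ
  filter_upwards [h] with z hz
  obtain ⟨⟨x₁, c₁⟩, hq, rfl⟩ := hz
  exact ⟨x₁, rfl, hq⟩

lemma fibInd_open {X Y : Type*} [TopologicalSpace X] [TopologicalSpace Y]
    {f : X → Y} (hopen : IsOpenMap f) {n : ℕ} {y : Y} {h : ℕ → C(X, ℝ)}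
    (hI : FibInd f n y h) : ∀ᶠ y' in 𝓝 y, FibInd f n y' h := by
  let S : X → (ℕ → ℝ) → ℝ := fun x c => ∑ i ∈ Finset.range n, c i * h i x
  have hS : Continuous fun z : X × (ℕ → ℝ) => S z.1 z.2 := by
    dsimp only [S]
    fun_prop
  let K : Set (ℕ → ℝ) := (Set.pi univ fun _ => Icc (-1 : ℝ) 1) ∩
    ⋃ i ∈ Finset.range n, {c | |c i| = 1}
  have hK : IsCompact K := by
    apply (isCompact_univ_pi fun _ => isCompact_Icc).inter_right
    apply isClosed_biUnion_finset
    intro i _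
    exact isClosed_eq (by fun_prop) continuous_const
  have key : ∀ᶠ y' in 𝓝 y, ∀ c ∈ K, ∃ x x', f x = y' ∧ f x' = y' ∧ S x c < S x' c := by
    apply hK.eventually_forall_of_forall_eventually
    intro c hc
    obtain ⟨x, x', hx, hx', hlt⟩ : ∃ x x', f x = y ∧ f x' = y ∧ S x c < S x' c := by
      by_contra! hcon
      have h0 := hI c fun x x' hx hx' => le_antisymm (hcon x' x hx' hx) (hcon x x' hx hx')
      obtain ⟨i, hi, hci⟩ := by simpa using hc.2
      have := h0 i hi
      simp [this] at hci
    obtain ⟨r, hr1, hr2⟩ := exists_between hlt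
    have e1 := open_lift hopen (Q := fun x c => S x c < r) (x := x) (c := c)
      (hS.continuousAt.eventually_lt continuousAt_const hr1)
    have e2 := open_lift hopen (Q := fun x c => r < S x c) (x := x') (c := c)
      (continuousAt_const.eventually_lt hS.continuousAt hr2)
    rw [hx] at e1
    rw [hx'] at e2
    filter_upwards [e1, e2] with z ⟨a, ha, ha'⟩ ⟨b, hb, hb'⟩
    exact ⟨a, b, ha, hb, ha'.trans hb'⟩
  filter_upwards [key] with y' hy' c hc
  by_contra! hne
  obtain ⟨i₀, hi₀, hci₀⟩ := hne
  obtain ⟨j, hj, hjmax⟩ := Finset.exists_max_image (Finset.range n) (fun i => |c i|)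
    ⟨i₀, Finset.mem_range.2 hi₀⟩
  have hjpos : 0 < |c j| := (abs_pos.2 hci₀).trans_le (hjmax i₀ (Finset.mem_range.2 hi₀))
  let c' : ℕ → ℝ := fun i => if i < n then c i / |c j| else 0
  have hc'S : ∀ x, S x c' = (∑ i ∈ Finset.range n, c i * h i x) / |c j| := by
    intro x
    dsimp only [S]
    rw [Finset.sum_div]
    apply Finset.sum_congr rfl
    intro i hi
    simp only [c', if_pos (Finset.mem_range.1 hi)]
    ring
  have hc'K : c' ∈ K := by
    constructor
    · intro i _
      refine mem_Icc.2 (abs_le.1 ?_)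
      by_cases hi : i < n
      · simp only [c', if_pos hi, abs_div, abs_abs]
        rw [div_le_one hjpos]
        exact hjmax i (Finset.mem_range.2 hi)
      · simp [c', hi]
    · simp only [mem_iUnion]
      refine ⟨j, hj, ?_⟩
      simp only [c', if_pos (Finset.mem_range.1 hj), mem_ofPred_eq, abs_div, abs_abs]
      exact div_self hjpos.ne'
  obtain ⟨x, x', hx, hx', hlt⟩ := hy' c' hc'K
  rw [hc'S, hc'S, hc x x' hx hx'] at hlt
  exact lt_irrefl _ hlt

lemma exists_notMem_span {X : Type*} [TopologicalSpace X] [CompletelyRegularSpace X] [T2Space X]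
    {A : Set X} (hA : A.Infinite) {S : Set (A → ℝ)} (hS : S.Finite) :
    ∃ g : C(X, ℝ), (fun a : A => g a) ∉ Submodule.span ℝ S := by
  classical
  by_contra! hcon
  set M := Submodule.span ℝ S
  have : FiniteDimensional ℝ M := FiniteDimensional.span_of_finite ℝ hS
  obtain ⟨p, hpA, hp⟩ := hA.exists_subset_card_eq (Module.finrank ℝ M + 1)
  have hg : ∀ x : p, ∃ g : C(X, ℝ), g x = 1 ∧ ∀ x' : p, x' ≠ x → g x' = 0 := by
    intro x
    obtain ⟨u, hu, hux, huK⟩ := CompletelyRegularSpace.completely_regular (x : X)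
      ((p.erase x : Finset X) : Set X) (Finset.finite_toSet _).isClosed (by simp)
    refine ⟨⟨fun z => 1 - (u z : ℝ), by fun_prop⟩, by simp [hux], ?_⟩
    intro x' hne
    have : u x' = 1 := huK (by simp [Subtype.coe_injective.ne hne])
    simp [this]
  choose g hg1 hg0 using hg
  let v : p → M := fun x => ⟨fun a : A => g x a, hcon (g x)⟩
  have hv : LinearIndependent ℝ v := by
    rw [Fintype.linearIndependent_iff]
    intro c hc x
    have h1 := congrFun (congrArg Subtype.val hc) ⟨x, hpA x.2⟩
    simp only [Submodule.coe_sum, Submodule.coe_smul, Finset.sum_apply, Pi.smul_apply, v,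
      smul_eq_mul, Submodule.coe_zero, Pi.zero_apply] at h1
    rw [Finset.sum_eq_single x] at h1
    · simpa [hg1] using h1
    · intro b _ hb
      rw [hg0 b x hb.symm, mul_zero]
    · simp
  have := hv.fintype_card_le_finrank
  rw [Fintype.card_coe, hp] at this
  omega

lemma exists_new {X Y : Type*} [TopologicalSpace X] [CompletelyRegularSpace X] [T2Space X]
    {f : X → Y} {y : Y} (hy : (f ⁻¹' {y}).Infinite) {n : ℕ} {T : Set (ℕ → C(X, ℝ))}
    (hT : T.Finite) (hI : ∀ h ∈ T, FibInd f n y h) :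
    ∃ g : C(X, ℝ), ∀ h ∈ T, FibInd f (n + 1) y (Function.update h n g) := by
  let r : C(X, ℝ) → (f ⁻¹' {y} → ℝ) := fun g a => g a
  let S : Set (f ⁻¹' {y} → ℝ) :=
    insert 1 (⋃ i ∈ Finset.range n, (fun h : ℕ → C(X, ℝ) => r (h i)) '' T)
  have hS : S.Finite := by
    apply Set.Finite.insert
    apply Set.Finite.biUnion (Finset.finite_toSet _)
    intro i _
    exact hT.image _
  obtain ⟨g, hg⟩ := exists_notMem_span hy hS
  refine ⟨g, fun h hh c hc => ?_⟩
  have hsum : ∀ x, ∑ i ∈ Finset.range (n + 1), c i * (Function.update h n g) i x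
      = ∑ i ∈ Finset.range n, c i * h i x + c n * g x := by
    intro x
    rw [Finset.sum_range_succ, Function.update_self]
    congr 1
    apply Finset.sum_congr rfl
    intro i hi
    rw [Function.update_of_ne (Finset.mem_range.1 hi).ne]
  simp only [hsum] at hc
  have hcn : c n = 0 := by
    by_contra hne
    apply hg
    obtain ⟨x₀, hx₀⟩ := hy.nonempty
    set k := ∑ i ∈ Finset.range n, c i * h i x₀ + c n * g x₀ with hk
    have : (fun a : f ⁻¹' {y} => g a) =
        (c n)⁻¹ • (k • (1 : f ⁻¹' {y} → ℝ) - ∑ i ∈ Finset.range n, c i • r (h i)) := by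
      funext a
      have := hc a x₀ a.2 hx₀
      simp only [Pi.smul_apply, Pi.sub_apply, Pi.one_apply, Finset.sum_apply, smul_eq_mul, r]
      rw [← hk] at this
      rw [← this]
      field_simp
      ring
    rw [this]
    refine Submodule.smul_mem _ _ (Submodule.sub_mem _ (Submodule.smul_mem _ _
      (Submodule.subset_span (mem_insert _ _))) (Submodule.sum_mem _ fun i hi =>
        Submodule.smul_mem _ _ (Submodule.subset_span (mem_insert_of_mem _ ?_))))
    simp only [mem_iUnion]
    exact ⟨i, hi, mem_image_of_mem _ hh⟩
  have h1 := hI h hh c (by simpa [hcn] using hc)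
  intro i hi
  rcases Nat.lt_succ_iff_lt_or_eq.1 hi with hi | rfl
  · exact h1 i hi
  · exact hcn

/-- A finite-valued upper semicontinuous family of possible `n`-tuples, all independent. -/
def GoodState {X Y : Type*} [TopologicalSpace X] [TopologicalSpace Y] (f : X → Y) (n : ℕ)
    (T : Y → Set (ℕ → C(X, ℝ))) : Prop :=
  (∀ y, (T y).Finite) ∧ (∀ y, ∀ᶠ y' in 𝓝 y, T y' ⊆ T y) ∧ ∀ y, ∀ h ∈ T y, FibInd f n y h

/-- The extension of a state by a new layer. -/
def extState {X Y : Type*} [TopologicalSpace X] (n : ℕ)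
    (T : Y → Set (ℕ → C(X, ℝ))) (G : Y → Set C(X, ℝ)) : Y → Set (ℕ → C(X, ℝ)) :=
  fun y => Set.image2 (fun h g => Function.update h n g) (T y) (G y)

/-- The functions in the layer are locally constant choices. -/
def LayerCover {X Y : Type*} [TopologicalSpace X] [TopologicalSpace Y]
    (G : Y → Set C(X, ℝ)) : Prop :=
  ∀ y, ∃ U : Set Y, IsOpen U ∧ y ∈ U ∧ ∃ g, ∀ y' ∈ U, g ∈ G y'

lemma exists_layer {X Y : Type*} [TopologicalSpace X] [CompletelyRegularSpace X] [T2Space X]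
    [TopologicalSpace Y] [T2Space Y] [ParacompactSpace Y]
    {f : X → Y} (hopen : IsOpenMap f) (hinf : ∀ y : Y, (f ⁻¹' {y}).Infinite)
    {n : ℕ} {T : Y → Set (ℕ → C(X, ℝ))} (hT : GoodState f n T) :
    ∃ G : Y → Set C(X, ℝ), LayerCover G ∧ GoodState f (n + 1) (extState n T G) := by
  obtain ⟨hfin, husc, hind⟩ := hT
  choose g hg using fun y => exists_new (hinf y) (hfin y) (hind y)
  have hu : ∀ y, ∃ u : Set Y, IsOpen u ∧ y ∈ u ∧ ∀ y' ∈ closure u, ∀ h ∈ T y',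
      FibInd f (n + 1) y' (Function.update h n (g y)) := by
    intro y
    have h1 : ∀ᶠ y' in 𝓝 y, ∀ h ∈ T y, FibInd f (n + 1) y' (Function.update h n (g y)) :=
      (Filter.eventually_all_finite (hfin y)).2 fun h hh => fibInd_open hopen (hg y h hh)
    have h2 : ∀ᶠ y' in 𝓝 y, ∀ h ∈ T y', FibInd f (n + 1) y' (Function.update h n (g y)) := by
      filter_upwards [h1, husc y] with y' a b h hh
      exact a h (b hh)
    obtain ⟨t, ht, htc, hts⟩ := exists_mem_nhds_isClosed_subset h2
    refine ⟨interior t, isOpen_interior, mem_interior_iff_mem_nhds.2 ht, fun y' hy' => ?_⟩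
    exact hts (closure_minimal interior_subset htc hy')
  choose u huo hyu hu using hu
  obtain ⟨v, hvo, hvc, hvl, hvu⟩ := precise_refinement u huo
    (eq_univ_of_forall fun y => mem_iUnion.2 ⟨y, hyu y⟩)
  refine ⟨fun y' => g '' {y | y' ∈ closure (v y)}, ?_, ?_, ?_, ?_⟩
  · intro y
    obtain ⟨z, hz⟩ := mem_iUnion.1 (hvc ▸ mem_univ y)
    exact ⟨v z, hvo z, hz, g z, fun y' hy' => mem_image_of_mem g (subset_closure hy')⟩
  · intro y
    exact (hfin y).image2 _ ((hvl.closure.point_finite y).image g)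
  · intro y
    filter_upwards [husc y, hvl.closure.eventually_subset (fun _ => isClosed_closure) y]
      with y' a b
    exact image2_subset a (image_mono b)
  · rintro y _ ⟨h, hh, _, ⟨z, hz, rfl⟩, rfl⟩
    exact hu z y (closure_mono (hvu z) hz) h hh

lemma exists_layers {X Y : Type*} [TopologicalSpace X] [CompletelyRegularSpace X] [T2Space X]
    [TopologicalSpace Y] [T2Space Y] [ParacompactSpace Y]
    {f : X → Y} (hopen : IsOpenMap f) (hinf : ∀ y : Y, (f ⁻¹' {y}).Infinite) :
    ∃ G : ℕ → Y → Set C(X, ℝ), (∀ n, LayerCover (G n)) ∧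
      ∀ n y, ∀ h : ℕ → C(X, ℝ), (∀ i, h i ∈ G i y) → FibInd f n y h := by
  choose! L hL1 hL2 using fun (n : ℕ) (T : Y → Set (ℕ → C(X, ℝ))) (hT : GoodState f n T) =>
    exists_layer hopen hinf hT
  let T : ℕ → Y → Set (ℕ → C(X, ℝ)) :=
    fun n => Nat.rec (fun _ => {0}) (fun n T => extState n T (L n T)) n
  have hTs : ∀ n, T (n + 1) = extState n (T n) (L n (T n)) := fun n => rfl
  have hT : ∀ n, GoodState f n (T n) := by
    intro n
    induction n with
    | zero =>
      refine ⟨fun y => finite_singleton _, fun y => Eventually.of_forall fun _ => subset_rfl, ?_⟩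
      intro y h _ c _ i hi
      omega
    | succ n ih =>
      rw [hTs]
      exact hL2 n _ ih
  refine ⟨fun n => L n (T n), fun n => hL1 n _ (hT n), ?_⟩
  intro n y h hh
  have hmem : ∀ n, (fun i => if i < n then h i else 0) ∈ T n y := by
    intro n
    induction n with
    | zero => simp [T]; rfl
    | succ n ih =>
      rw [hTs]
      refine ⟨_, ih, h n, hh n, ?_⟩
      funext i
      by_cases hi : i = n
      · subst hi; simp
      · beta_reduce
        rw [Function.update_of_ne hi]
        have : i < n + 1 ↔ i < n := by omega
        simp [this]
  have h1 := (hT n).2.2 y _ (hmem n)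
  intro c hc
  apply h1 c
  intro x x' hx hx'
  have hs : ∀ x, ∑ i ∈ Finset.range n, c i * (if i < n then h i else 0 : C(X, ℝ)) x =
      ∑ i ∈ Finset.range n, c i * h i x := by
    intro x
    apply Finset.sum_congr rfl
    intro i hi
    rw [if_pos (Finset.mem_range.1 hi)]
  simp only [hs]
  exact hc x x' hx hx'

lemma exists_nonconst {X Y : Type*} [TopologicalSpace X] [CompletelyRegularSpace X] [T2Space X]
    [TopologicalSpace Y] [T2Space Y] [ParacompactSpace Y] (hY : IsCSpace Y)
    {f : X → Y} (hf : Continuous f) (hopen : IsOpenMap f)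
    (hinf : ∀ y : Y, (f ⁻¹' {y}).Infinite) :
    ∃ F : C(X, ℝ), ∀ y, ∃ x x', f x = y ∧ f x' = y ∧ F x < F x' := by
  classical
  obtain ⟨G, hGc, hGi⟩ := exists_layers hopen hinf
  obtain ⟨V, hV, hVc⟩ := hY (fun n => {U | IsOpen U ∧ ∃ g, ∀ y' ∈ U, g ∈ G n y'}) (by
    intro n
    refine ⟨fun U hU => hU.1, eq_univ_of_forall fun y => ?_⟩
    obtain ⟨U, hU, hyU, hg⟩ := hGc n y
    exact ⟨U, ⟨hU, hg⟩, hyU⟩)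
  let ι := {p : ℕ × Set Y // p.2 ∈ V p.1}
  have hg : ∀ i : ι, ∃ g, ∀ y ∈ i.1.2, g ∈ G i.1.1 y := by
    intro i
    obtain ⟨W', ⟨_, g, hg⟩, hW'⟩ := (hV i.1.1).2.2 _ i.2
    exact ⟨g, fun y hy => hg y (hW' hy)⟩
  choose g hg using hg
  obtain ⟨ρ, hρ⟩ := PartitionOfUnity.exists_isSubordinate isClosed_univ (fun i : ι => i.1.2)
    (fun i => (hV i.1.1).1 _ i.2) (by
      intro y _
      have : y ∈ ⋃₀ ⋃ n, V n := hVc ▸ mem_univ y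
      obtain ⟨U, hU, hyU⟩ := this
      obtain ⟨n, hn⟩ := mem_iUnion.1 hU
      exact mem_iUnion.2 ⟨⟨(n, U), hn⟩, hyU⟩)
  have hcont : Continuous fun x => ∑ᶠ i, ρ i (f x) * g i x := by
    apply continuous_finsum
    · intro i
      fun_prop
    · refine (ρ.locallyFinite.preimage_continuous hf).subset ?_
      intro i x hx
      exact left_ne_zero_of_mul hx
  refine ⟨⟨_, hcont⟩, fun y => ?_⟩
  by_contra! hcon
  have hF : ∀ x, f x = y → ∑ᶠ i, ρ i (f x) * g i x = ∑ i ∈ ρ.finsupport y, ρ i y * g i x := by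
    rintro x rfl
    apply finsum_eq_sum_of_support_subset
    rw [ρ.coe_finsupport]
    intro i hi
    exact left_ne_zero_of_mul hi
  have hmemU : ∀ i ∈ ρ.finsupport y, y ∈ i.1.2 := by
    intro i hi
    exact hρ i (subset_tsupport _ ((ρ.mem_finsupport y).1 hi))
  have hinj : ∀ i ∈ ρ.finsupport y, ∀ j ∈ ρ.finsupport y, i.1.1 = j.1.1 → i = j := by
    rintro ⟨⟨n, U⟩, hU⟩ hi ⟨⟨m, U'⟩, hU'⟩ hj hnm
    obtain rfl : n = m := hnm
    have : U = U' := by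
      by_contra hne
      exact disjoint_left.1 ((hV n).2.1 hU hU' hne) (hmemU _ hi) (hmemU _ hj)
    subst this
    rfl
  have hh : ∀ n, ∃ h : C(X, ℝ), h ∈ G n y ∧ ∀ i ∈ ρ.finsupport y, i.1.1 = n → h = g i := by
    intro n
    by_cases hex : ∃ i ∈ ρ.finsupport y, i.1.1 = n
    · obtain ⟨i, hi, rfl⟩ := hex
      refine ⟨g i, hg i y (hmemU i hi), fun j hj hji => ?_⟩
      rw [hinj j hj i hi hji]
    · obtain ⟨U, _, hyU, g', hg'⟩ := hGc n y
      exact ⟨g', hg' y hyU, fun i hi hin => (hex ⟨i, hi, hin⟩).elim⟩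
  choose h hhG hhg using hh
  obtain ⟨N, hN⟩ : ∃ N, ∀ i ∈ ρ.finsupport y, i.1.1 < N := by
    refine ⟨(ρ.finsupport y).sup (fun i => i.1.1) + 1, fun i hi => ?_⟩
    exact Nat.lt_succ_of_le (Finset.le_sup (f := fun i : ι => i.1.1) hi)
  let c : ℕ → ℝ := fun n => ∑ i ∈ ρ.finsupport y with i.1.1 = n, ρ i y
  have hmaps : ∀ i ∈ ρ.finsupport y, i.1.1 ∈ Finset.range N :=
    fun i hi => Finset.mem_range.2 (hN i hi)
  have hsum : ∀ x, ∑ n ∈ Finset.range N, c n * h n x = ∑ i ∈ ρ.finsupport y, ρ i y * g i x := by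
    intro x
    rw [← Finset.sum_fiberwise_of_maps_to hmaps]
    apply Finset.sum_congr rfl
    intro n _
    rw [Finset.sum_mul]
    apply Finset.sum_congr rfl
    intro i hi
    obtain ⟨hi, hin⟩ := Finset.mem_filter.1 hi
    rw [hhg n i hi hin]
  have hc := hGi N y h hhG c (by
    intro x x' hx hx'
    rw [hsum, hsum, ← hF x hx, ← hF x' hx']
    exact le_antisymm (hcon x' x hx' hx) (hcon x x' hx hx'))
  have h1 : ∑ n ∈ Finset.range N, c n = 1 := by
    rw [Finset.sum_fiberwise_of_maps_to hmaps]
    exact ρ.sum_finsupport (mem_univ y)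
  rw [Finset.sum_eq_zero fun n hn => hc n (Finset.mem_range.1 hn)] at h1
  exact zero_ne_one h1

theorem statement0 {X Y : Type*} [TopologicalSpace X] [CompletelyRegularSpace X] [T2Space X]
    [TopologicalSpace Y] [T2Space Y] [ParacompactSpace Y] (hY : IsCSpace Y)
    (f : X → Y) (hf : Continuous f) (hopen : IsOpenMap f) (hsurj : Function.Surjective f)
    (hfib : ∀ y : Y, (f ⁻¹' {y}).Infinite ∧ CStarEmbedded (f ⁻¹' {y})) :
    ∃ F₀ F₁ : Set X, IsClosed F₀ ∧ IsClosed F₁ ∧ Disjoint F₀ F₁ ∧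
      f '' F₀ = Set.univ ∧ f '' F₁ = Set.univ := by
  obtain ⟨F, hF⟩ := exists_nonconst hY hf hopen fun y => (hfib y).1
  let t : Y → Set (ℝ × ℝ) := fun y =>
    {p | p.1 < p.2 ∧ (∃ x, f x = y ∧ F x < p.1) ∧ ∃ x, f x = y ∧ p.2 < F x}
  have ht : ∀ y, Convex ℝ (t y) := by
    rintro y ⟨a, b⟩ ⟨h1, ⟨x, hx, hxa⟩, x', hx', hxb⟩ ⟨a', b'⟩ ⟨h1', ⟨z, hz, hza⟩, z', hz', hzb⟩
      s r hs hr hsr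
    obtain rfl : r = 1 - s := by linarith
    simp only at *
    refine ⟨?_, ?_, ?_⟩
    · simp only [Prod.smul_mk, Prod.mk_add_mk, smul_eq_mul]
      rcases hs.eq_or_lt with rfl | hs'
      · linarith
      · nlinarith
    · simp only [Prod.smul_mk, Prod.mk_add_mk, smul_eq_mul]
      rcases le_total a a' with h | h
      · exact ⟨x, hx, by nlinarith⟩
      · exact ⟨z, hz, by nlinarith⟩
    · simp only [Prod.smul_mk, Prod.mk_add_mk, smul_eq_mul]
      rcases le_total b b' with h | h
      · exact ⟨z', hz', by nlinarith⟩
      · exact ⟨x', hx', by nlinarith⟩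
  obtain ⟨φ, hφ⟩ := exists_continuous_forall_mem_convex_of_local_const ht (by
    intro y
    obtain ⟨x, x', hx, hx', hlt⟩ := hF y
    obtain ⟨a, ha, ha'⟩ := exists_between hlt
    obtain ⟨b, hb, hb'⟩ := exists_between ha'
    refine ⟨(a, b), ?_⟩
    have e1 : f '' {z | F z < a} ∈ 𝓝 y := by
      rw [← hx]
      exact hopen.image_mem_nhds (F.continuous.continuousAt.eventually_lt continuousAt_const ha)
    have e2 : f '' {z | b < F z} ∈ 𝓝 y := by
      rw [← hx']
      exact hopen.image_mem_nhds (continuousAt_const.eventually_lt F.continuous.continuousAt hb')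
    filter_upwards [e1, e2] with y' ⟨z, hz, hzy⟩ ⟨z', hz', hzy'⟩
    exact ⟨hb, ⟨z, hzy, hz⟩, z', hzy', hz'⟩)
  refine ⟨{x | F x ≤ (φ (f x)).1}, {x | (φ (f x)).2 ≤ F x}, ?_, ?_, ?_, ?_, ?_⟩
  · exact isClosed_le F.continuous (by fun_prop)
  · exact isClosed_le (by fun_prop) F.continuous
  · rw [disjoint_left]
    intro x h0 h1
    have h0' : F x ≤ (φ (f x)).1 := h0
    have h1' : (φ (f x)).2 ≤ F x := h1
    have := (hφ (f x)).1
    linarith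
  · refine eq_univ_of_forall fun y => ?_
    obtain ⟨x, rfl, hlt⟩ := (hφ y).2.1
    exact ⟨x, hlt.le, rfl⟩
  · refine eq_univ_of_forall fun y => ?_
    obtain ⟨x, rfl, hlt⟩ := (hφ y).2.2
    exact ⟨x, hlt.le, rfl⟩
end

section
/- Let X be a topological space and A ⊂ X a nonempty C*-embedded subset of X. Then the restriction map π_A : C(X,[0,1]) → C(A,[0,1]), sending f to f↾A, is a continuous open surjection, where C(X,[0,1]) and C(A,[0,1]) denote the spaces of continuous [0,1]-valued functions equipped with the sup-metric d(g,h) = sup{|g(z) − h(z)| : z}. -/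
open Set Topology Filter

open BoundedContinuousFunction in
/-- Controlled extension: `h` close to `f` on `A` extends to a function close to `f` on `X`. -/
theorem cstar_controlled_ext {X : Type*} [TopologicalSpace X] (A : Set X)
    (hemb : CStarEmbedded A) (f : X →ᵇ ℝ) (hf : ∀ x, f x ∈ Set.Icc (0 : ℝ) 1)
    (h : ↥A →ᵇ ℝ) (hh : ∀ a, h a ∈ Set.Icc (0 : ℝ) 1) (δ : ℝ) (hδ : 0 ≤ δ)
    (hc : ∀ a : A, |h a - f a| ≤ δ) :
    ∃ F : X →ᵇ ℝ, (∀ x, F x ∈ Set.Icc (0 : ℝ) 1) ∧ (∀ a : A, F a = h a) ∧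
      dist F f ≤ δ := by
  obtain ⟨G, hG⟩ := hemb h.toContinuousMap ⟨1, fun a => by
    have := hh a
    exact abs_le.2 ⟨by have := this.1; simp at *; linarith, this.2⟩⟩
  have hcont : Continuous (fun x => max (max 0 (f x - δ)) (min (min 1 (f x + δ)) (G x))) := by
    have := f.continuous
    fun_prop
  have hb : ∀ x, max (max 0 (f x - δ)) (min (min 1 (f x + δ)) (G x)) ∈ Set.Icc (0 : ℝ) 1 := by
    intro x
    have := hf x
    refine ⟨le_max_of_le_left (le_max_left _ _), max_le (max_le zero_le_one ?_) ?_⟩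
    · linarith [this.2]
    · exact (min_le_left _ _).trans (min_le_left _ _)
  refine ⟨BoundedContinuousFunction.ofNormedAddCommGroup _ hcont 1 (fun x => ?_), hb, ?_, ?_⟩
  · rw [Real.norm_eq_abs, abs_of_nonneg (hb x).1]
    exact (hb x).2
  · intro a
    have h1 : G a = h a := hG a
    have h2 := abs_le.1 (hc a)
    have h3 := hh a
    change max (max 0 (f a - δ)) (min (min 1 (f a + δ)) (G a)) = h a
    rw [h1, min_eq_right (le_min h3.2 (by linarith)),
      max_eq_right (max_le h3.1 (by linarith))]
  · refine (BoundedContinuousFunction.dist_le hδ).2 fun x => ?_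
    have h3 := hf x
    change |max (max 0 (f x - δ)) (min (min 1 (f x + δ)) (G x)) - f x| ≤ δ
    rw [abs_le]
    constructor
    · have : f x - δ ≤ max (max 0 (f x - δ)) (min (min 1 (f x + δ)) (G x)) :=
        le_max_of_le_left (le_max_right _ _)
      linarith
    · have : max (max 0 (f x - δ)) (min (min 1 (f x + δ)) (G x)) ≤ f x + δ :=
        max_le (max_le (by linarith [h3.1]) (by linarith))
          ((min_le_left _ _).trans (min_le_right _ _))
      linarith

open BoundedContinuousFunction in
/-- `C(Z,[0,1])` realized as the bounded continuous functions `Z →ᵇ ℝ` with values in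
`[0,1]`; the subtype carries the sup-metric of `Z →ᵇ ℝ`. -/
theorem statement2 {X : Type*} [TopologicalSpace X] (A : Set X) (hA : A.Nonempty)
    (hemb : CStarEmbedded A)
    (π : {g : X →ᵇ ℝ // ∀ x, g x ∈ Set.Icc (0 : ℝ) 1} →
         {g : ↥A →ᵇ ℝ // ∀ a, g a ∈ Set.Icc (0 : ℝ) 1})
    (hπ : ∀ g, ∀ a : A, (π g).1 a = g.1 a) :
    Continuous π ∧ IsOpenMap π ∧ Function.Surjective π := by
  refine ⟨?_, ?_, ?_⟩
  · refine LipschitzWith.continuous (K := 1) (LipschitzWith.of_dist_le_mul fun f g => ?_)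
    rw [NNReal.coe_one, one_mul]
    refine (BoundedContinuousFunction.dist_le dist_nonneg).2 fun a => ?_
    rw [hπ, hπ]
    exact BoundedContinuousFunction.dist_coe_le_dist (f := f.1) (g := g.1) (a : X)
  · intro U hU
    rw [Metric.isOpen_iff] at hU ⊢
    rintro _ ⟨f, hfU, rfl⟩
    obtain ⟨ε, hε, hball⟩ := hU f hfU
    refine ⟨ε, hε, fun h hh => ?_⟩
    obtain ⟨F, hF, hFA, hd⟩ := cstar_controlled_ext A hemb f.1 f.2 h.1 h.2
      (dist h (π f)) dist_nonneg (fun a => by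
        rw [← hπ]
        exact BoundedContinuousFunction.dist_coe_le_dist (f := h.1) (g := (π f).1) a)
    refine ⟨⟨F, hF⟩, hball ?_, ?_⟩
    · exact lt_of_le_of_lt hd hh
    · apply Subtype.ext
      ext a
      rw [hπ]
      exact hFA a
  · intro h
    obtain ⟨F, hF, hFA, -⟩ := cstar_controlled_ext A hemb 0 (fun x => by simp) h.1 h.2
      1 zero_le_one (fun a => by
        have := h.2 a
        simpa [abs_of_nonneg this.1] using this.2)
    refine ⟨⟨F, hF⟩, ?_⟩
    apply Subtype.ext
    ext a
    rw [hπ]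
    exact hFA a
end

section
/- Let X and Y be topological spaces and f : X → Y an open surjective map. Define the set-valued mapping Θ : Y → subsets of C(X,[0,1]) by Θ(y) = { g ∈ C(X,[0,1]) : g is constant on f⁻¹(y) }. Then Θ has a closed graph; that is, the set {(y,g) ∈ Y × C(X,[0,1]) : g ∈ Θ(y)} is closed in Y × C(X,[0,1]), where C(X,[0,1]) carries the sup-metric topology. -/
open Set Topology Filter

open BoundedContinuousFunction in
/-- The mapping `Θ(y) = {g ∈ C(X,[0,1]) : g is constant on f⁻¹(y)}` has closed graph,
where `C(X,[0,1])` is realized as `[0,1]`-valued members of `X →ᵇ ℝ` with the sup-metric. -/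
theorem statement4 {X Y : Type*} [TopologicalSpace X] [TopologicalSpace Y]
    (f : X → Y) (hopen : IsOpenMap f) (hsurj : Function.Surjective f) :
    IsClosed {p : Y × {g : X →ᵇ ℝ // ∀ x, g x ∈ Set.Icc (0 : ℝ) 1} |
      ∃ c : ℝ, ∀ x ∈ f ⁻¹' {p.1}, p.2.1 x = c} := by
  rw [← isOpen_compl_iff, isOpen_iff_mem_nhds]
  rintro ⟨y, g⟩ hp
  have hne : ∃ x₁ x₂, f x₁ = y ∧ f x₂ = y ∧ g.1 x₁ ≠ g.1 x₂ := by
    by_contra! h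
    obtain ⟨x₀, hx₀⟩ := hsurj y
    exact hp ⟨g.1 x₀, fun x hx => h x x₀ hx hx₀⟩
  obtain ⟨x₁, x₂, h₁, h₂, hne⟩ := hne
  obtain ⟨U₁, U₂, hU₁, hU₂, m₁, m₂, hd⟩ := t2_separation hne
  have key : ∀ (x : X) (U : Set ℝ), f x = y → IsOpen U → g.1 x ∈ U →
      ∀ᶠ q : Y × {g : X →ᵇ ℝ // ∀ x, g x ∈ Set.Icc (0 : ℝ) 1} in 𝓝 (y, g),
        ∃ z, f z = q.1 ∧ q.2.1 z ∈ U := by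
    intro x U hx hU hm
    have hc : Continuous (fun q : (X →ᵇ ℝ) × X => q.1 q.2) :=
      continuous_eval
    have hn : ∀ᶠ q in 𝓝 (g.1, x), q.1 q.2 ∈ U :=
      hc.continuousAt.eventually_mem (hU.mem_nhds hm)
    rw [nhds_prod_eq, Filter.eventually_prod_iff] at hn
    obtain ⟨P, hP, Q, hQ, hPQ⟩ := hn
    have hQ' : f '' {z | Q z} ∈ 𝓝 y := hx ▸ hopen.image_mem_nhds hQ
    have hP' : ∀ᶠ k : {g : X →ᵇ ℝ // ∀ x, g x ∈ Set.Icc (0 : ℝ) 1} in 𝓝 g, P k.1 :=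
      continuous_subtype_val.continuousAt.eventually hP
    rw [nhds_prod_eq]
    filter_upwards [Filter.prod_mem_prod hQ' hP']
    rintro ⟨y', k⟩ ⟨⟨z, hz, hzy⟩, hk⟩
    exact ⟨z, hzy, hPQ hk hz⟩
  filter_upwards [key x₁ U₁ h₁ hU₁ m₁, key x₂ U₂ h₂ hU₂ m₂]
  rintro q ⟨z₁, e₁, k₁⟩ ⟨z₂, e₂, k₂⟩ ⟨c, hc⟩
  rw [hc z₁ e₁] at k₁
  rw [hc z₂ e₂] at k₂
  exact Set.disjoint_left.1 hd k₁ k₂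
end

section
/- Let (Z,ρ) be a metric space, Y a paracompact Hausdorff C-space, and Φ : Y → subsets of Z a lower semicontinuous set-valued mapping such that each Φ(y) is infinite and ρ-complete. Then Φ has a Michael pair (φ,ψ) such that Φ(y) \ ψ(y) ≠ ∅ for every y ∈ Y. -/
open Set Topology Filter

/-- A set-valued map is lower semicontinuous. -/
def IsLSCMap {Y Z : Type*} [TopologicalSpace Y] [TopologicalSpace Z] (Φ : Y → Set Z) : Prop :=
  ∀ U : Set Z, IsOpen U → IsOpen {y | (Φ y ∩ U).Nonempty}

/-- A set-valued map is upper semicontinuous. -/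
def IsUSCMap {Y Z : Type*} [TopologicalSpace Y] [TopologicalSpace Z] (Φ : Y → Set Z) : Prop :=
  ∀ U : Set Z, IsOpen U → IsOpen {y | Φ y ⊆ U}

/-- `(φ, ψ)` is a Michael pair for `Φ`: `φ` is compact-valued (nonempty) and l.s.c.,
`ψ` is compact-valued (nonempty) and u.s.c., and `φ(y) ⊆ ψ(y) ⊆ Φ(y)` for all `y`. -/
def MichaelPair {Y Z : Type*} [TopologicalSpace Y] [TopologicalSpace Z]
    (Φ φ ψ : Y → Set Z) : Prop :=
  (∀ y, (φ y).Nonempty) ∧ (∀ y, IsCompact (φ y)) ∧ IsLSCMap φ ∧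
  (∀ y, (ψ y).Nonempty) ∧ (∀ y, IsCompact (ψ y)) ∧ IsUSCMap ψ ∧
  (∀ y, φ y ⊆ ψ y) ∧ (∀ y, ψ y ⊆ Φ y)

section MichaelAux

lemma isComplete_of_closed_subset {Z : Type*} [MetricSpace Z] {S T : Set Z} (hT : IsComplete T)
    (hS : IsClosed S) (hST : S ⊆ T) : IsComplete S := by
  intro f hf hfS
  obtain ⟨x, _, hx⟩ := hT f hf (hfS.trans (principal_mono.2 hST))
  have := hf.1
  exact ⟨x, hS.mem_of_frequently_of_tendsto
    (Eventually.frequently (le_principal_iff.1 hfS)) (tendsto_id'.2 hx), hx⟩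

lemma kur_aux {Z : Type*} [MetricSpace Z] (A : ℕ → Set Z) (hanti : Antitone A)
    (hcl : ∀ n, IsClosed (A n)) (T : Set Z) (hTc : IsComplete T)
    (hT : ∀ n, ∀ x ∈ A n, ∃ x' ∈ T, x' ∈ A n ∧ dist x x' ≤ 2 * (1/2 : ℝ)^n)
    (hfin : ∀ n, ∃ F : Set (Set Z), F.Finite ∧ A n ⊆ ⋃₀ F ∧
      ∀ S ∈ F, ∀ x ∈ S, ∀ x' ∈ S, dist x x' ≤ 2 * (1/2 : ℝ)^n) :
    (⋂ n, A n) ⊆ T ∧ IsCompact (⋂ n, A n) ∧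
      ∀ U : Set Z, IsOpen U → (⋂ n, A n) ⊆ U → ∃ n, A n ⊆ U := by
  have hlim : Tendsto (fun n : ℕ => 2 * (1/2 : ℝ)^n) atTop (𝓝 0) := by
    have := (tendsto_pow_atTop_nhds_zero_of_lt_one (r := (1/2 : ℝ)) (by norm_num) (by norm_num))
    simpa using this.const_mul 2
  have hsmall : ∀ ε > 0, ∃ n : ℕ, 2 * (1/2 : ℝ)^n < ε := fun ε hε =>
    ((hlim.eventually (gt_mem_nhds hε))).exists
  have hsub : (⋂ n, A n) ⊆ T := by
    intro x hx
    rw [← hTc.isClosed.closure_eq, Metric.mem_closure_iff]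
    intro ε hε
    obtain ⟨n, hn⟩ := hsmall ε hε
    obtain ⟨x', h1, _, h3⟩ := hT n x (mem_iInter.1 hx n)
    exact ⟨x', h1, h3.trans_lt hn⟩
  refine ⟨hsub, ?_, ?_⟩
  · rw [isCompact_iff_totallyBounded_isComplete]
    constructor
    · rw [Metric.totallyBounded_iff]
      intro ε hε
      obtain ⟨n, hn⟩ := hsmall ε hε
      obtain ⟨F, hF, hc, hd⟩ := hfin n
      classical
      by_cases hZ : Nonempty Z
      · obtain ⟨z0⟩ := hZ
        let p : Set Z → Z := fun S => if h : S.Nonempty then h.some else z0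
        refine ⟨p '' F, hF.image _, ?_⟩
        intro x hx
        obtain ⟨S, hS, hxS⟩ := hc (mem_iInter.1 hx n)
        have hne : S.Nonempty := ⟨x, hxS⟩
        have hp : p S ∈ S := by
          simp only [p, dif_pos hne]; exact hne.some_mem
        refine mem_biUnion (mem_image_of_mem _ hS) ?_
        exact (hd S hS x hxS _ hp).trans_lt hn
      · refine ⟨∅, finite_empty, fun x _ => (hZ ⟨x⟩).elim⟩
    · exact isComplete_of_closed_subset hTc (isClosed_iInter hcl) hsub
  · intro U hU hAU
    by_contra! hcon
    have h1 : ∀ n, ∃ x ∈ A n, x ∉ U := fun n => not_subset.1 (hcon n)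
    choose x hxA hxU using h1
    choose x' hx'T hx'A hxx' using fun n => hT n (x n) (hxA n)
    let f : Ultrafilter Z := (hyperfilter ℕ).map x'
    have hle : (hyperfilter ℕ : Filter ℕ) ≤ atTop := by
      simpa [Nat.cofinite_eq_atTop] using (hyperfilter_le_cofinite (α := ℕ))
    have hfA : ∀ n, A n ∈ f := by
      intro n
      change x' ⁻¹' (A n) ∈ (hyperfilter ℕ : Filter ℕ)
      refine hle ?_
      filter_upwards [eventually_ge_atTop n] with k hk
      exact hanti hk (hx'A k)
    have hfc : Cauchy (f : Filter Z) := by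
      rw [Metric.cauchy_iff]
      refine ⟨f.neBot, ?_⟩
      intro ε hε
      obtain ⟨n, hn⟩ := hsmall ε hε
      obtain ⟨F, hF, hc, hd⟩ := hfin n
      have : ⋃₀ F ∈ f := mem_of_superset (hfA n) hc
      rw [Ultrafilter.finite_sUnion_mem_iff hF] at this
      obtain ⟨S, hS, hSf⟩ := this
      exact ⟨S, hSf, fun a ha b hb => (hd S hS a ha b hb).trans_lt hn⟩
    have hfT : (f : Filter Z) ≤ 𝓟 T := by
      rw [le_principal_iff]
      change x' ⁻¹' T ∈ (hyperfilter ℕ : Filter ℕ)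
      exact univ_mem' hx'T
    obtain ⟨a, haT, ha⟩ := hTc f hfc hfT
    have ht' : Tendsto x' (hyperfilter ℕ : Filter ℕ) (𝓝 a) := ha
    have hd0 : Tendsto (fun n => dist (x' n) (x n)) (hyperfilter ℕ : Filter ℕ) (𝓝 0) := by
      refine squeeze_zero (fun _ => dist_nonneg) (fun n => ?_) (hlim.mono_left hle)
      rw [dist_comm]; exact hxx' n
    have ht : Tendsto x (hyperfilter ℕ : Filter ℕ) (𝓝 a) :=
      (tendsto_iff_of_dist hd0).1 ht'
    have haA : a ∈ ⋂ n, A n := by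
      refine mem_iInter.2 fun n => (hcl n).mem_of_tendsto ht ?_
      refine hle ?_
      filter_upwards [eventually_ge_atTop n] with k hk
      exact hanti hk (hxA k)
    obtain ⟨k, hk⟩ := (ht.eventually (hU.mem_nhds (hAU haA))).exists
    exact hxU k hk

/-- Iterated intersection of balls along a list of centres. -/
def ballList {Z : Type*} [MetricSpace Z] : List Z → Set Z
  | [] => univ
  | z :: s => Metric.ball z ((1/2 : ℝ)^s.length) ∩ ballList s

/-- Union at level `n` of the pieces that are active at `y`. -/
def levelSet {Y Z : Type*} [MetricSpace Z] (D : List Z → Set Y) (n : ℕ) (y : Y) : Set Z :=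
  ⋃ s ∈ {s : List Z | s.length = n ∧ y ∈ D s}, closure (ballList s)

lemma isOpen_ballList {Z : Type*} [MetricSpace Z] (s : List Z) : IsOpen (ballList s) := by
  induction s with
  | nil => exact isOpen_univ
  | cons z s ih => exact Metric.isOpen_ball.inter ih

lemma ballList_dist {Z : Type*} [MetricSpace Z] (s : List Z) (n : ℕ) (hs : s.length = n + 1)
    (x x' : Z) (hx : x ∈ closure (ballList s)) (hx' : x' ∈ closure (ballList s)) :
    dist x x' ≤ 2 * (1/2 : ℝ)^n := by
  cases s with
  | nil => simp at hs
  | cons z s =>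
    have hl : s.length = n := by simpa using hs
    have hsub : closure (ballList (z :: s)) ⊆ Metric.closedBall z ((1/2 : ℝ)^n) := by
      refine closure_minimal ?_ Metric.isClosed_closedBall
      rw [← hl]
      exact inter_subset_left.trans Metric.ball_subset_closedBall
    have h1 := Metric.mem_closedBall.1 (hsub hx)
    have h2 := Metric.mem_closedBall.1 (hsub hx')
    have := dist_triangle_right x x' z
    linarith

lemma levelSet_anti {Y Z : Type*} [MetricSpace Z] (D : List Z → Set Y)
    (hD : ∀ z s, D (z :: s) ⊆ D s) (y : Y) : Antitone (fun n => levelSet D n y) := by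
  refine antitone_nat_of_succ_le fun n => ?_
  intro x hx
  simp only [levelSet, mem_iUnion, mem_ofPred_eq, exists_prop] at hx ⊢
  obtain ⟨s, ⟨hs, hy⟩, hx⟩ := hx
  cases s with
  | nil => simp at hs
  | cons z s => exact ⟨s, ⟨by simpa using hs, hD z s hy⟩, closure_mono inter_subset_right hx⟩

theorem michael_pair {Y Z : Type*} [TopologicalSpace Y] [T2Space Y] [ParacompactSpace Y]
    [MetricSpace Z] (Φ : Y → Set Z) (hΦ : IsLSCMap Φ) (hne : ∀ y, (Φ y).Nonempty)
    (hc : ∀ y, IsComplete (Φ y)) : ∃ φ ψ : Y → Set Z, MichaelPair Φ φ ψ := by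
  let P : List Z → Set Y := fun s => {y | (Φ y ∩ ballList s).Nonempty}
  have hPo : ∀ s, IsOpen (P s) := fun s => hΦ _ (isOpen_ballList s)
  have hPc : ∀ s, P s ⊆ ⋃ z, P (z :: s) := by
    rintro s y ⟨z, hz, hzs⟩
    exact mem_iUnion.2 ⟨z, z, hz, Metric.mem_ball_self (by positivity), hzs⟩
  have hG : ∀ (s : List Z) (D : Set Y), ∃ G : Z → Set Y, IsClosed D → D ⊆ P s →
      (∀ z, IsOpen (G z)) ∧ (∀ z, closure (G z) ⊆ P (z :: s)) ∧ LocallyFinite G ∧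
      D ⊆ ⋃ z, G z := by
    intro s D
    by_cases h : IsClosed D ∧ D ⊆ P s
    · obtain ⟨v, hvo, hvc, hvl, hvs⟩ := precise_refinement_set h.1 (fun z => P (z :: s))
        (fun z => hPo _) (h.2.trans (hPc s))
      obtain ⟨w, hwc, hwo, hws⟩ := exists_subset_iUnion_closure_subset h.1 hvo
        (fun x _ => hvl.point_finite x) hvc
      exact ⟨w, fun _ _ => ⟨hwo, fun z => (hws z).trans (hvs z),
        hvl.subset fun z => subset_closure.trans (hws z), hwc⟩⟩
    · exact ⟨fun _ => ∅, fun h1 h2 => (h ⟨h1, h2⟩).elim⟩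
  choose G hG using hG
  let D : List Z → Set Y := fun s => List.rec univ (fun z s d => d ∩ closure (G s d z)) s
  have hD0 : D [] = univ := rfl
  have hDs : ∀ z s, D (z :: s) = D s ∩ closure (G s (D s) z) := fun _ _ => rfl
  let O : List Z → Set Y := fun s => List.rec univ (fun z s o => o ∩ G s (D s) z) s
  have hO0 : O [] = univ := rfl
  have hOs : ∀ z s, O (z :: s) = O s ∩ G s (D s) z := fun _ _ => rfl
  clear_value D O
  have hDP : ∀ s, IsClosed (D s) ∧ D s ⊆ P s := by
    intro s
    induction s with
    | nil =>
      rw [hD0]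
      exact ⟨isClosed_univ, fun y _ => by simpa [P, ballList] using hne y⟩
    | cons z s ih =>
      rw [hDs]
      exact ⟨ih.1.inter isClosed_closure,
        inter_subset_right.trans ((hG s _ ih.1 ih.2).2.1 z)⟩
  have hG' := fun s => hG s (D s) (hDP s).1 (hDP s).2
  have hOD : ∀ s, IsOpen (O s) ∧ O s ⊆ D s := by
    intro s
    induction s with
    | nil => rw [hO0, hD0]; exact ⟨isOpen_univ, subset_rfl⟩
    | cons z s ih =>
      rw [hOs, hDs]
      exact ⟨ih.1.inter ((hG' s).1 z), inter_subset_inter ih.2 subset_closure⟩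
  have hOc : ∀ s, ∀ y ∈ O s, ∃ z, y ∈ O (z :: s) := by
    intro s y hy
    obtain ⟨z, hz⟩ := mem_iUnion.1 ((hG' s).2.2.2 ((hOD s).2 hy))
    exact ⟨z, by rw [hOs]; exact ⟨hy, hz⟩⟩
  have hDm : ∀ z s, D (z :: s) ⊆ D s := fun z s => by rw [hDs]; exact inter_subset_left
  have hOm : ∀ z s, O (z :: s) ⊆ O s := fun z s => by rw [hOs]; exact inter_subset_left
  have hfin : ∀ n y, {s : List Z | s.length = n ∧ y ∈ D s}.Finite := by
    intro n y
    induction n with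
    | zero =>
      refine (finite_singleton []).subset ?_
      rintro s ⟨hs, _⟩
      exact List.length_eq_zero_iff.1 hs
    | succ n ih =>
      have : {s : List Z | s.length = n + 1 ∧ y ∈ D s} ⊆
          ⋃ s ∈ {s : List Z | s.length = n ∧ y ∈ D s},
            (fun z => z :: s) '' {z | y ∈ closure (G s (D s) z)} := by
        rintro (_ | ⟨z, s⟩) ⟨hs, hy⟩
        · simp at hs
        · rw [hDs] at hy
          exact mem_biUnion (show s ∈ {s : List Z | s.length = n ∧ y ∈ D s} from
            ⟨by simpa using hs, hy.1⟩) ⟨z, hy.2, rfl⟩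
      refine (ih.biUnion fun s _ => ?_).subset this
      exact ((hG' s).2.2.1.closure.point_finite y).image _
  have hnhd : ∀ n y, ∀ᶠ y' in 𝓝 y, ∀ s : List Z, s.length = n → y' ∈ D s → y ∈ D s := by
    intro n y
    induction n with
    | zero =>
      refine Eventually.of_forall fun y' s hs _ => ?_
      rw [List.length_eq_zero_iff.1 hs, hD0]; trivial
    | succ n ih =>
      have h2 : ∀ᶠ y' in 𝓝 y, ∀ s ∈ {s : List Z | s.length = n ∧ y ∈ D s},
          ∀ z, y' ∈ closure (G s (D s) z) → y ∈ closure (G s (D s) z) := by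
        rw [eventually_all_finite (hfin n y)]
        intro s _
        have := (hG' s).2.2.1.closure.iInter_compl_mem_nhds (fun _ => isClosed_closure) y
        filter_upwards [this] with y' hy' z hz
        by_contra hn
        exact (mem_iInter₂.1 hy' z hn) hz
      filter_upwards [ih, h2] with y' h1 h2
      rintro (_ | ⟨z, s⟩) hs hy
      · simp at hs
      · have hs' : s.length = n := by simpa using hs
        rw [hDs] at hy ⊢
        have := h1 s hs' hy.1
        exact ⟨this, h2 s ⟨hs', this⟩ z hy.2⟩
  have hOfin : ∀ n y, {s : List Z | s.length = n ∧ y ∈ O s}.Finite := fun n y =>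
    (hfin n y).subset fun s hs => ⟨hs.1, (hOD s).2 hs.2⟩
  have hkur := fun y => kur_aux (fun n => levelSet D (n+1) y)
    (fun a b hab => levelSet_anti D hDm y (Nat.succ_le_succ hab))
    (fun n => (hfin (n+1) y).isClosed_biUnion fun s _ => isClosed_closure) (Φ y) (hc y)
    (by
      intro n x hx
      simp only [levelSet, mem_iUnion, mem_ofPred_eq, exists_prop] at hx ⊢
      obtain ⟨s, ⟨hs, hy⟩, hx⟩ := hx
      obtain ⟨x', hx', hxs⟩ := (hDP s).2 hy
      exact ⟨x', hx', ⟨s, ⟨hs, hy⟩, subset_closure hxs⟩,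
        ballList_dist s n hs _ _ hx (subset_closure hxs)⟩)
    (by
      intro n
      refine ⟨(fun s => closure (ballList s)) '' {s : List Z | s.length = n+1 ∧ y ∈ D s},
        (hfin (n+1) y).image _, ?_, ?_⟩
      · rw [sUnion_image]; exact subset_rfl
      · rintro _ ⟨s, hs, rfl⟩ x hx x' hx'
        exact ballList_dist s n hs.1 _ _ hx hx')
  have hbr : ∀ s y, y ∈ O s → ∃ x, x ∈ closure (ballList s) ∧ ∀ n, x ∈ levelSet O (n+1) y := by
    intro s0 y hy
    have : Nonempty Z := ⟨(hne y).some⟩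
    choose! nz hnz using hOc
    let b : ℕ → List Z := fun n => Nat.rec s0 (fun _ s => nz s y :: s) n
    have hb0 : b 0 = s0 := rfl
    have hbs : ∀ n, b (n+1) = nz (b n) y :: b n := fun _ => rfl
    clear_value b
    have hbO : ∀ n, y ∈ O (b n) := by
      intro n
      induction n with
      | zero => rw [hb0]; exact hy
      | succ n ih => rw [hbs]; exact hnz _ _ ih
    have hbl : ∀ n, (b n).length = s0.length + n := by
      intro n
      induction n with
      | zero => rw [hb0]; rfl
      | succ n ih => rw [hbs, List.length_cons, ih]; omega
    have hbanti : Antitone (fun n => ballList (b n)) := by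
      refine antitone_nat_of_succ_le fun n => ?_
      change ballList (b (n+1)) ⊆ ballList (b n)
      rw [hbs]; exact inter_subset_right
    choose x hxΦ hxb using fun n => (hDP (b (n+1))).2 ((hOD _).2 (hbO (n+1)))
    have hcau : CauchySeq x := by
      refine cauchySeq_of_le_geometric (1/2) 2 (by norm_num) fun n => ?_
      have := ballList_dist (b (n+1)) (s0.length + n) (by rw [hbl]; omega) (x n) (x (n+1))
        (subset_closure (hxb n)) (subset_closure (hbanti (Nat.le_succ (n+1)) (hxb (n+1))))
      refine this.trans ?_
      have : (1/2 : ℝ)^(s0.length + n) ≤ (1/2)^n :=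
        pow_le_pow_of_le_one (by norm_num) (by norm_num) (by omega)
      linarith
    obtain ⟨a, _, ha⟩ := cauchySeq_tendsto_of_isComplete (hc y) hxΦ hcau
    have haB : ∀ n, a ∈ closure (ballList (b n)) := by
      intro n
      refine mem_closure_of_tendsto ha ?_
      filter_upwards [eventually_ge_atTop n] with k hk
      exact hbanti (by omega : n ≤ k + 1) (hxb k)
    refine ⟨a, hb0 ▸ haB 0, ?_⟩
    intro n
    refine levelSet_anti O hOm y (by omega : n + 1 ≤ s0.length + (n+1)) ?_
    exact mem_biUnion (show b (n+1) ∈ {s : List Z | s.length = s0.length + (n+1) ∧ y ∈ O s} from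
      ⟨hbl _, hbO _⟩) (haB (n+1))
  have hsub : ∀ y, (⋂ n, levelSet O (n+1) y) ⊆ ⋂ n, levelSet D (n+1) y := by
    intro y
    refine iInter_mono fun n => biUnion_subset_biUnion_left ?_
    exact fun s hs => ⟨hs.1, (hOD s).2 hs.2⟩
  have hneO : ∀ y, (⋂ n, levelSet O (n+1) y).Nonempty := by
    intro y
    obtain ⟨x, _, hx⟩ := hbr [] y (by rw [hO0]; trivial)
    exact ⟨x, mem_iInter.2 hx⟩
  refine ⟨fun y => ⋂ n, levelSet O (n+1) y, fun y => ⋂ n, levelSet D (n+1) y, hneO, ?_, ?_,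
    fun y => (hneO y).mono (hsub y), fun y => (hkur y).2.1, ?_, hsub, fun y => (hkur y).1⟩
  · intro y
    refine (hkur y).2.1.of_isClosed_subset ?_ (hsub y)
    exact isClosed_iInter fun n => (hOfin (n+1) y).isClosed_biUnion fun s _ => isClosed_closure
  · intro U hU
    rw [isOpen_iff_mem_nhds]
    rintro y ⟨x, hx, hxU⟩
    obtain ⟨r, hr, hrU⟩ := Metric.isOpen_iff.1 hU x hxU
    obtain ⟨n, hn⟩ := exists_pow_lt_of_lt_one (half_pos hr) (by norm_num : (1/2 : ℝ) < 1)
    have h1 := mem_iInter.1 hx n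
    simp only [levelSet, mem_iUnion, mem_ofPred_eq, exists_prop] at h1
    obtain ⟨s, ⟨hs, hy⟩, hxs⟩ := h1
    filter_upwards [(hOD s).1.mem_nhds hy] with y' hy'
    obtain ⟨x', hx's, hx'⟩ := hbr s y' hy'
    refine ⟨x', mem_iInter.2 hx', hrU ?_⟩
    have := ballList_dist s n hs x' x hx's hxs
    rw [Metric.mem_ball]
    linarith
  · intro U hU
    rw [isOpen_iff_mem_nhds]
    intro y hy
    obtain ⟨n, hn⟩ := (hkur y).2.2 U hU hy
    filter_upwards [hnhd (n+1) y] with y' hy'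
    refine (iInter_subset _ n).trans (Subset.trans ?_ hn)
    exact biUnion_subset_biUnion_left fun s hs => ⟨hs.1, hy' s hs.1 hs.2⟩

end MichaelAux

section CSpaceAux

open BoundedContinuousFunction

/-- `q` is not constant on `S`. -/
def NonConstOn {Z : Type*} [MetricSpace Z] (q : (Z →ᵇ ℝ)) (S : Set Z) : Prop :=
  ∃ z ∈ S, ∃ z' ∈ S, q z < q z'

lemma nonConstOn_of_not_const {Z : Type*} [MetricSpace Z] {q : (Z →ᵇ ℝ)} {S : Set Z}
    (h : ¬ ∃ c, ∀ z ∈ S, q z = c) : NonConstOn q S := by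
  by_contra hn
  unfold NonConstOn at hn
  push Not at hn
  refine h ?_
  by_cases hS : S.Nonempty
  · obtain ⟨z0, h0⟩ := hS
    exact ⟨q z0, fun z hz => le_antisymm (hn z0 h0 z hz) (hn z hz z0 h0)⟩
  · exact ⟨0, fun z hz => (hS ⟨z, hz⟩).elim⟩

lemma NonConstOn.smul {Z : Type*} [MetricSpace Z] {q : (Z →ᵇ ℝ)} {S : Set Z}
    (h : NonConstOn q S) {c : ℝ} (hc : 0 < c) : NonConstOn (c • q) S := by
  obtain ⟨z, hz, z', hz', hlt⟩ := h
  exact ⟨z, hz, z', hz', by simpa using mul_lt_mul_of_pos_left hlt hc⟩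

lemma exists_indep {Z : Type*} [MetricSpace Z] (S : Set Z) (hS : S.Infinite)
    (M : Submodule ℝ (Z →ᵇ ℝ)) [FiniteDimensional ℝ M] :
    ∃ h : (Z →ᵇ ℝ), ∀ q ∈ M, NonConstOn (h + q) S := by
  classical
  let M' : Submodule ℝ (Z →ᵇ ℝ) := M ⊔ Submodule.span ℝ {1}
  let N := Module.finrank ℝ M' + 1
  let e : ℕ ↪ S := hS.natEmbedding
  let ev : (Z →ᵇ ℝ) →ₗ[ℝ] (Fin N → ℝ) :=
    { toFun := fun q i => q (e i)
      map_add' := fun _ _ => rfl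
      map_smul' := fun _ _ => rfl }
  have hev : ∀ q i, ev q i = q (e i) := fun _ _ => rfl
  have hlt : Module.finrank ℝ (M'.map ev) < N :=
    Nat.lt_succ_of_le (Submodule.finrank_map_le ev M')
  have hne : M'.map ev ≠ ⊤ := by
    intro h
    rw [h, finrank_top] at hlt
    simp at hlt
  obtain ⟨v, hv⟩ : ∃ v, v ∉ M'.map ev := by
    by_contra! h
    exact hne (Submodule.eq_top_iff'.2 h)
  let b : Fin N → (Z →ᵇ ℝ) := fun i =>
    BoundedContinuousFunction.ofNormedAddCommGroup
      (fun z => ∏ j ∈ Finset.univ.erase i, min 1 (dist z (e j)))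
      (continuous_finsetProd _ fun j _ =>
        continuous_const.min (continuous_id.dist continuous_const)) 1 (by
          intro z
          have h0 : ∀ j : Fin N, 0 ≤ min 1 (dist z (e j)) := fun j => le_min zero_le_one dist_nonneg
          rw [Real.norm_of_nonneg (Finset.prod_nonneg fun j _ => h0 j)]
          exact Finset.prod_le_one (fun j _ => h0 j) fun j _ => min_le_left _ _)
  have hb : ∀ i z, b i z = ∏ j ∈ Finset.univ.erase i, min 1 (dist z (e j)) := fun _ _ => rfl
  have hb0 : ∀ i j, i ≠ j → b i (e j) = 0 := by
    intro i j hij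
    rw [hb]
    exact Finset.prod_eq_zero (Finset.mem_erase.2 ⟨hij.symm, Finset.mem_univ _⟩) (by simp)
  have hb1 : ∀ i, b i (e i) ≠ 0 := by
    intro i
    rw [hb, Finset.prod_ne_zero_iff]
    intro j hj
    have hpos : 0 < min 1 (dist (e i : Z) (e j)) := by
      refine lt_min one_pos (dist_pos.2 ?_)
      intro h
      have := e.injective (Subtype.ext h)
      exact (Finset.mem_erase.1 hj).1 (Fin.ext this).symm
    exact hpos.ne'
  let h : (Z →ᵇ ℝ) := ∑ i, (v i / b i (e i)) • b i
  have hh : ev h = v := by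
    ext j
    rw [hev]
    simp only [h, BoundedContinuousFunction.coe_sum, Finset.sum_apply, BoundedContinuousFunction.coe_smul, smul_eq_mul]
    rw [Finset.sum_eq_single j]
    · exact div_mul_cancel₀ _ (hb1 j)
    · intro i _ hij
      rw [hb0 i j hij, mul_zero]
    · simp
  refine ⟨h, fun q hq => nonConstOn_of_not_const ?_⟩
  rintro ⟨c, hc⟩
  apply hv
  refine ⟨c • (1 : (Z →ᵇ ℝ)) - q, ?_, ?_⟩
  · refine M'.sub_mem (M'.smul_mem _ ?_) ?_
    · exact Submodule.mem_sup_right (Submodule.mem_span_singleton_self _)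
    · exact Submodule.mem_sup_left hq
  · rw [← hh]
    ext i
    rw [hev, hev]
    have := hc (e i) (e i).2
    simp at this ⊢
    linarith

/-- The join of two sets: all the segments between them, together with both sets. -/
def joinSet {E : Type*} [AddCommGroup E] [Module ℝ E] (A B : Set E) : Set E :=
  A ∪ B ∪ (fun p : ℝ × E × E => p.1 • p.2.1 + (1 - p.1) • p.2.2) '' (Icc (0:ℝ) 1 ×ˢ A ×ˢ B)

lemma joinSet_mono {E : Type*} [AddCommGroup E] [Module ℝ E] {A B A' B' : Set E}
    (hA : A ⊆ A') (hB : B ⊆ B') : joinSet A B ⊆ joinSet A' B' :=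
  union_subset_union (union_subset_union hA hB)
    (image_mono (prod_mono subset_rfl (prod_mono hA hB)))

/-- The invariant of the recursive construction. -/
def Good {Y Z : Type*} [TopologicalSpace Y] [MetricSpace Z] (Φ : Y → Set Z)
    (Q : Y → Set (Z →ᵇ ℝ)) : Prop :=
  (∀ y, ∃ M : Submodule ℝ (Z →ᵇ ℝ), FiniteDimensional ℝ M ∧ Q y ⊆ M) ∧
  (∀ y, IsCompact (Q y)) ∧
  (∀ y, ∀ᶠ y' in 𝓝 y, Q y' ⊆ Q y) ∧
  (∀ y, ∀ q ∈ Q y, NonConstOn q (Φ y))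

lemma isOpen_lsc_graph {Y Z : Type*} [TopologicalSpace Y] [TopologicalSpace Z] {Φ : Y → Set Z}
    (hΦ : IsLSCMap Φ) (G : Set (Y × Z)) (hG : IsOpen G) :
    IsOpen {y | ∃ z ∈ Φ y, (y, z) ∈ G} := by
  rw [isOpen_iff_mem_nhds]
  rintro y ⟨z, hz, hyz⟩
  obtain ⟨u, v, hu, hv, hyu, hzv, huv⟩ := isOpen_prod_iff.1 hG y z hyz
  filter_upwards [hu.mem_nhds hyu, (hΦ v hv).mem_nhds ⟨z, hz, hzv⟩] with y' h1 h2
  obtain ⟨z', h3, h4⟩ := h2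
  exact ⟨z', h3, huv ⟨h1, h4⟩⟩

lemma nonConst_eventually {Y Z : Type*} [TopologicalSpace Y] [MetricSpace Z] {Φ : Y → Set Z}
    (hΦ : IsLSCMap Φ) (y : Y) (q : (Z →ᵇ ℝ)) (h : NonConstOn q (Φ y)) :
    ∀ᶠ p in 𝓝 (y, q), NonConstOn p.2 (Φ p.1) := by
  obtain ⟨z, hz, z', hz', hlt⟩ := h
  obtain ⟨c, hc1, hc2⟩ := exists_between hlt
  have hev : Continuous fun p : (Z →ᵇ ℝ) × Z => p.1 p.2 := continuous_eval
  have key : ∀ (G : Set ℝ), IsOpen G → ∀ x ∈ Φ y, q x ∈ G →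
      ∀ᶠ p : Y × (Z →ᵇ ℝ) in 𝓝 (y, q), ∃ z ∈ Φ p.1, p.2 z ∈ G := by
    intro G hG x hx hxG
    obtain ⟨u, v, hu, hv, hqu, hxv, huv⟩ := isOpen_prod_iff.1 (hG.preimage hev) q x hxG
    have h1 : {y | (Φ y ∩ v).Nonempty} ×ˢ u ∈ 𝓝 (y, q) :=
      prod_mem_nhds ((hΦ v hv).mem_nhds ⟨x, hx, hxv⟩) (hu.mem_nhds hqu)
    filter_upwards [h1] with p hp
    obtain ⟨w, hw, hwv⟩ := hp.1
    exact ⟨w, hw, huv (mk_mem_prod hp.2 hwv)⟩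
  filter_upwards [key (Iio c) isOpen_Iio z hz hc1, key (Ioi c) isOpen_Ioi z' hz' hc2]
    with p h1 h2
  obtain ⟨a, ha, hac⟩ := h1
  obtain ⟨b, hb, hbc⟩ := h2
  exact ⟨a, ha, b, hb, lt_trans hac hbc⟩

lemma isCompact_joinSet {E : Type*} [AddCommGroup E] [Module ℝ E] [TopologicalSpace E]
    [ContinuousAdd E] [ContinuousSMul ℝ E] {A B : Set E} (hA : IsCompact A) (hB : IsCompact B) :
    IsCompact (joinSet A B) := by
  refine (hA.union hB).union ((isCompact_Icc.prod (hA.prod hB)).image ?_)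
  fun_prop

lemma step_aux {Y Z : Type*} [TopologicalSpace Y] [T2Space Y] [ParacompactSpace Y]
    [MetricSpace Z] {Φ : Y → Set Z} (hΦ : IsLSCMap Φ) (hinf : ∀ y, (Φ y).Infinite)
    (Q : Y → Set (Z →ᵇ ℝ)) (hQ : Good Φ Q) :
    ∃ H : Y → Set (Z →ᵇ ℝ), Good Φ (fun y => joinSet (Q y) (H y)) ∧
      ∀ y, ∃ h, ∀ᶠ y' in 𝓝 y, h ∈ H y' := by
  obtain ⟨hfd, hcp, hld, hnc⟩ := hQ
  have hloc : ∀ y0, ∃ (h : Z →ᵇ ℝ) (N : Set Y), IsOpen N ∧ y0 ∈ N ∧ ∀ y ∈ N,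
      Q y ⊆ Q y0 ∧ ∀ q ∈ joinSet (Q y0) {h}, NonConstOn q (Φ y) := by
    intro y0
    obtain ⟨M, hM, hQM⟩ := hfd y0
    obtain ⟨h, hh⟩ := exists_indep (Φ y0) (hinf y0) M
    have h0 : NonConstOn h (Φ y0) := by simpa using hh 0 M.zero_mem
    have hj : ∀ q ∈ joinSet (Q y0) {h}, NonConstOn q (Φ y0) := by
      rintro q ((hq | rfl) | ⟨⟨t, q', h'⟩, ⟨ht, hq', rfl⟩, rfl⟩)
      · exact hnc y0 q hq
      · exact h0
      · dsimp only at ht hq' ⊢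
        rcases eq_or_lt_of_le ht.2 with rfl | hlt
        · simpa using hnc y0 q' hq'
        · have hpos : 0 < 1 - t := by linarith
          have := (hh ((t / (1 - t)) • q') (M.smul_mem _ (hQM hq'))).smul hpos
          rw [smul_add, smul_smul, mul_div_cancel₀ _ hpos.ne', add_comm] at this
          exact this
    have hcj : IsCompact (joinSet (Q y0) {h}) := isCompact_joinSet (hcp y0) isCompact_singleton
    have hev : ∀ᶠ y in 𝓝 y0, ∀ q ∈ joinSet (Q y0) {h}, NonConstOn q (Φ y) :=
      hcj.eventually_forall_of_forall_eventually fun q hq =>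
        nonConst_eventually hΦ y0 q (hj q hq)
    obtain ⟨N, hN, hNo, hyN⟩ := eventually_nhds_iff.1 ((hld y0).and hev)
    exact ⟨h, N, hNo, hyN, hN⟩
  choose h N hNo hyN hN using hloc
  obtain ⟨v, hvo, hvc, hvl, hvs⟩ := precise_refinement_set isClosed_univ N hNo
    (fun y _ => mem_iUnion.2 ⟨y, hyN y⟩)
  obtain ⟨w, hwc, hwo, hws⟩ := exists_subset_iUnion_closure_subset isClosed_univ hvo
    (fun x _ => hvl.point_finite x) hvc
  have hwl : LocallyFinite fun i => closure (w i) := hvl.subset hws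
  have hHfin : ∀ y, (h '' {i | y ∈ closure (w i)}).Finite := fun y =>
    (hwl.point_finite y).image _
  refine ⟨fun y => h '' {i | y ∈ closure (w i)}, ⟨?_, ?_, ?_, ?_⟩, ?_⟩
  · intro y
    obtain ⟨M, hM, hQM⟩ := hfd y
    have := FiniteDimensional.span_of_finite ℝ (hHfin y)
    refine ⟨M ⊔ Submodule.span ℝ (h '' {i | y ∈ closure (w i)}), inferInstance, ?_⟩
    have h1 : Q y ⊆ (M ⊔ Submodule.span ℝ (h '' {i | y ∈ closure (w i)}) :
      Submodule ℝ (Z →ᵇ ℝ)) := fun q hq => Submodule.mem_sup_left (hQM hq)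
    have h2 : h '' {i | y ∈ closure (w i)} ⊆ (M ⊔ Submodule.span ℝ
      (h '' {i | y ∈ closure (w i)}) : Submodule ℝ (Z →ᵇ ℝ)) :=
      fun q hq => Submodule.mem_sup_right (Submodule.subset_span hq)
    rintro q ((hq | hq) | ⟨⟨t, q', h'⟩, ⟨ht, hq', hh'⟩, rfl⟩)
    · exact h1 hq
    · exact h2 hq
    · exact Submodule.add_mem _ (Submodule.smul_mem _ _ (h1 hq')) (Submodule.smul_mem _ _ (h2 hh'))
  · exact fun y => isCompact_joinSet (hcp y) (hHfin y).isCompact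
  · intro y
    filter_upwards [hld y, hwl.iInter_compl_mem_nhds (fun _ => isClosed_closure) y] with y' h1 h2
    refine joinSet_mono h1 (image_mono fun i hi => ?_)
    by_contra hn
    exact (mem_iInter₂.1 h2 i hn) hi
  · rintro y q ((hq | ⟨i, hi, rfl⟩) | ⟨⟨t, q', h'⟩, ⟨ht, hq', ⟨i, hi, rfl⟩⟩, rfl⟩)
    · exact hnc y q hq
    · exact (hN i y (hvs i (hws i hi))).2 _ (Or.inl (Or.inr rfl))
    · have := hN i y (hvs i (hws i hi))
      exact this.2 _ (Or.inr ⟨(t, q', h i), ⟨ht, this.1 hq', rfl⟩, rfl⟩)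
  · intro y
    obtain ⟨i, hi⟩ := mem_iUnion.1 (hwc (mem_univ y))
    refine ⟨h i, ?_⟩
    filter_upwards [(hwo i).mem_nhds hi] with y' hy'
    exact ⟨i, subset_closure hy', rfl⟩

theorem exists_nonconst_s7 {Y Z : Type*} [TopologicalSpace Y] [T2Space Y] [ParacompactSpace Y]
    (hY : IsCSpace Y) [MetricSpace Z] {Φ : Y → Set Z} (hΦ : IsLSCMap Φ)
    (hinf : ∀ y, (Φ y).Infinite) :
    ∃ g : Y × Z → ℝ, Continuous g ∧ ∀ y, ∃ z ∈ Φ y, ∃ z' ∈ Φ y, g (y, z) < g (y, z') := by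
  classical
  choose! H hH1 hH2 using fun Q hQ => step_aux hΦ hinf Q hQ
  let Q : ℕ → Y → Set (Z →ᵇ ℝ) := fun n =>
    Nat.rec (fun _ => ∅) (fun _ q => fun y => joinSet (q y) (H q y)) n
  have hQ0 : Q 0 = fun _ => ∅ := rfl
  have hQs : ∀ n, Q (n+1) = fun y => joinSet (Q n y) (H (Q n) y) := fun _ => rfl
  clear_value Q
  have hQ : ∀ n, Good Φ (Q n) := by
    intro n
    induction n with
    | zero =>
      rw [hQ0]
      refine ⟨fun y => ⟨⊥, inferInstance, empty_subset _⟩, fun y => isCompact_empty,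
        fun y => Eventually.of_forall fun _ => subset_rfl, fun y q hq => hq.elim⟩
    | succ n ih => rw [hQs]; exact hH1 _ ih
  obtain ⟨V, hV, hVc⟩ := hY (fun n => {U | IsOpen U ∧ ∃ h, ∀ y ∈ U, h ∈ H (Q n) y}) (by
    intro n
    refine ⟨fun U hU => hU.1, eq_univ_of_forall fun y => ?_⟩
    obtain ⟨h, hh⟩ := hH2 (Q n) (hQ n) y
    obtain ⟨U, hU, hUo, hyU⟩ := eventually_nhds_iff.1 hh
    exact ⟨U, ⟨hUo, h, hU⟩, hyU⟩)
  have hVo : ∀ n, ∀ U ∈ V n, IsOpen U := fun n => (hV n).1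
  have hVd : ∀ n, (V n).Pairwise Disjoint := fun n => (hV n).2.1
  have hVh : ∀ n U, ∃ h : Z →ᵇ ℝ, U ∈ V n → ∀ y ∈ U, h ∈ H (Q n) y := by
    intro n U
    by_cases hU : U ∈ V n
    · obtain ⟨W', ⟨_, h, hh⟩, hs⟩ := (hV n).2.2 U hU
      exact ⟨h, fun _ y hy => hh y (hs hy)⟩
    · exact ⟨0, fun h => (hU h).elim⟩
  choose hf hhf using hVh
  obtain ⟨p, hp⟩ := PartitionOfUnity.exists_isSubordinate (s := (univ : Set Y)) isClosed_univ
    (fun n => ⋃₀ V n) (fun n => isOpen_sUnion (hVo n)) (by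
      intro y _
      have : y ∈ ⋃₀ (⋃ n, V n) := by rw [hVc]; trivial
      obtain ⟨U, hU, hy⟩ := this
      obtain ⟨n, hn⟩ := mem_iUnion.1 hU
      exact mem_iUnion.2 ⟨n, U, hn, hy⟩)
  have hu : ∀ n y, ∃ u : Z →ᵇ ℝ, ∀ U ∈ V n, y ∈ U → u = hf n U := by
    intro n y
    by_cases hy : ∃ U ∈ V n, y ∈ U
    · obtain ⟨U, hU, hyU⟩ := hy
      refine ⟨hf n U, fun U' hU' hyU' => ?_⟩
      have : U = U' := by
        by_contra hne
        exact disjoint_left.1 (hVd n hU hU' hne) hyU hyU'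
      rw [this]
    · exact ⟨0, fun U hU hyU => (hy ⟨U, hU, hyU⟩).elim⟩
  choose u hu using hu
  refine ⟨fun x => ∑ᶠ n, p n x.1 * u n x.1 x.2, ?_, ?_⟩
  · refine continuous_finsum ?_ ?_
    · intro n
      rw [continuous_iff_continuousAt]
      rintro ⟨y, z⟩
      by_cases hy : y ∈ tsupport (p n)
      · obtain ⟨U, hU, hyU⟩ := hp n hy
        have hc : Continuous fun x : Y × Z => p n x.1 * hf n U x.2 := by fun_prop
        refine hc.continuousAt.congr ?_
        have : Prod.fst ⁻¹' U ∈ 𝓝 (y, z) :=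
          ((hVo n U hU).preimage continuous_fst).mem_nhds hyU
        filter_upwards [this] with x hx
        rw [hu n x.1 U hU hx]
      · refine (continuousAt_const (y := (0 : ℝ))).congr ?_
        have : Prod.fst ⁻¹' (tsupport (p n))ᶜ ∈ 𝓝 (y, z) :=
          ((isClosed_tsupport _).isOpen_compl.preimage continuous_fst).mem_nhds hy
        filter_upwards [this] with x hx
        have : p n x.1 = 0 := image_eq_zero_of_notMem_tsupport hx
        rw [this, zero_mul]
    · have hl := p.locallyFinite
      have := hl.preimage_continuous (continuous_fst : Continuous (Prod.fst : Y × Z → Y))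
      refine this.subset fun n x hx => ?_
      simp only [Function.mem_support] at hx
      exact left_ne_zero_of_mul hx
  · intro y
    have hcone : ∀ n, (∀ k < n, p k y = 0) ∨ ∃ q ∈ Q n y, ∃ s > (0 : ℝ),
        ∑ k ∈ Finset.range n, p k y • u k y = s • q := by
      intro n
      induction n with
      | zero => left; intro k hk; omega
      | succ n ih =>
        rcases eq_or_lt_of_le (p.nonneg n y) with h0 | hpos
        · rcases ih with ih | ⟨q, hq, s, hs, he⟩
          · left
            intro k hk
            rcases Nat.lt_succ_iff_lt_or_eq.1 hk with h | rfl
            · exact ih k h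
            · exact h0.symm
          · right
            refine ⟨q, by rw [hQs]; exact Or.inl (Or.inl hq), s, hs, ?_⟩
            rw [Finset.sum_range_succ, he, ← h0, zero_smul, add_zero]
        · right
          have huH : u n y ∈ H (Q n) y := by
            obtain ⟨U, hU, hyU⟩ := hp n (subset_tsupport _ (show p n y ≠ 0 from hpos.ne'))
            rw [hu n y U hU hyU]
            exact hhf n U hU y hyU
          rcases ih with ih | ⟨q, hq, s, hs, he⟩
          · refine ⟨u n y, by rw [hQs]; exact Or.inl (Or.inr huH), p n y, hpos, ?_⟩
            rw [Finset.sum_range_succ, Finset.sum_eq_zero, zero_add]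
            intro k hk
            rw [ih k (Finset.mem_range.1 hk), zero_smul]
          · have hsum : 0 < s + p n y := by linarith
            refine ⟨(s / (s + p n y)) • q + (1 - s / (s + p n y)) • u n y, ?_, s + p n y, hsum, ?_⟩
            · rw [hQs]
              refine Or.inr ⟨(s / (s + p n y), q, u n y), ⟨⟨by positivity, ?_⟩, hq, huH⟩, rfl⟩
              rw [div_le_one hsum]; linarith
            · rw [Finset.sum_range_succ, he, smul_add, smul_smul, smul_smul]
              congr 2
              · field_simp
              · field_simp
                ring
    have hfin : (Function.support fun n => p n y).Finite := p.locallyFinite.point_finite y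
    obtain ⟨n, hn⟩ : ∃ n, Function.support (fun n => p n y) ⊆ Finset.range n := by
      obtain ⟨n, hn⟩ := hfin.bddAbove
      exact ⟨n + 1, fun k hk => by simpa using Nat.lt_succ_of_le (hn hk)⟩
    rcases hcone n with h0 | ⟨q, hq, s, hs, he⟩
    · exfalso
      have h1 := p.sum_eq_one (mem_univ y)
      have h2 : ∀ k, p k y = 0 := by
        intro k
        by_contra hk
        exact hk (h0 k (by simpa using hn hk))
      simp [h2] at h1
    · obtain ⟨z, hz, z', hz', hlt⟩ := ((hQ n).2.2.2 y q hq).smul hs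
      have hg : ∀ x, ∑ᶠ k, p k y * u k y x = (s • q) x := by
        intro x
        rw [← he, finsum_eq_sum_of_support_subset (s := Finset.range n)]
        · simp
        · intro k hk
          exact hn (left_ne_zero_of_mul hk)
      exact ⟨z, hz, z', hz', by simp only [hg]; exact hlt⟩

end CSpaceAux

theorem statement7 {Y Z : Type*} [TopologicalSpace Y] [T2Space Y] [ParacompactSpace Y]
    (hY : IsCSpace Y) [MetricSpace Z]
    (Φ : Y → Set Z) (hΦlsc : IsLSCMap Φ)
    (hinf : ∀ y, (Φ y).Infinite) (hcompl : ∀ y, IsComplete (Φ y)) :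
    ∃ φ ψ : Y → Set Z, MichaelPair Φ φ ψ ∧ ∀ y, (Φ y \ ψ y).Nonempty := by
  obtain ⟨g, hg, hgn⟩ := exists_nonconst_s7 hY hΦlsc hinf
  have hlo : ∀ c : ℝ, IsOpen {y | ∃ z ∈ Φ y, g (y, z) < c} := fun c =>
    isOpen_lsc_graph hΦlsc {x | g x < c} (isOpen_lt hg continuous_const)
  have hhi : ∀ c : ℝ, IsOpen {y | ∃ z ∈ Φ y, c < g (y, z)} := fun c =>
    isOpen_lsc_graph hΦlsc {x | c < g x} (isOpen_lt continuous_const hg)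
  obtain ⟨α, hα⟩ := exists_continuous_forall_mem_convex_of_local_const
    (t := fun y => {c : ℝ | (∃ z ∈ Φ y, g (y, z) < c) ∧ ∃ z ∈ Φ y, c < g (y, z)}) (by
      intro y
      refine OrdConnected.convex ⟨?_⟩
      rintro a ⟨⟨z, hz, hza⟩, _⟩ b ⟨_, z', hz', hbz⟩ c ⟨hac, hcb⟩
      exact ⟨⟨z, hz, hza.trans_le hac⟩, z', hz', hcb.trans_lt hbz⟩) (by
      intro y
      obtain ⟨z, hz, z', hz', hlt⟩ := hgn y
      obtain ⟨c, h1, h2⟩ := exists_between hlt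
      refine ⟨c, ?_⟩
      filter_upwards [(hlo c).mem_nhds ⟨z, hz, h1⟩, (hhi c).mem_nhds ⟨z', hz', h2⟩]
        with y' h3 h4
      exact ⟨h3, h4⟩)
  have hgy : ∀ y, Continuous fun z => g (y, z) := fun y => hg.comp (by fun_prop)
  have hsub : ∀ y, closure {z | z ∈ Φ y ∧ g (y, z) < α y} ⊆ Φ y := fun y =>
    closure_minimal (fun z hz => hz.1) (hcompl y).isClosed
  obtain ⟨φ, ψ, h1, h2, h3, h4, h5, h6, h7, h8⟩ := michael_pair
    (fun y => closure {z | z ∈ Φ y ∧ g (y, z) < α y}) (by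
      intro U hU
      have := isOpen_lsc_graph hΦlsc {x : Y × Z | g x < α x.1 ∧ x.2 ∈ U}
        ((isOpen_lt hg (by fun_prop)).inter (hU.preimage continuous_snd))
      convert this using 1
      ext y
      constructor
      · rintro ⟨z, hz, hzU⟩
        obtain ⟨z', h1, h2⟩ := mem_closure_iff.1 hz U hU hzU
        exact ⟨z', h2.1, h2.2, h1⟩
      · rintro ⟨z, hz, hz1, hz2⟩
        exact ⟨z, subset_closure ⟨hz, hz1⟩, hz2⟩)
    (by
      intro y
      obtain ⟨⟨z, hz, hlt⟩, _⟩ := hα y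
      exact ⟨z, subset_closure ⟨hz, hlt⟩⟩)
    (fun y => isComplete_of_closed_subset (hcompl y) isClosed_closure (hsub y))
  refine ⟨φ, ψ, ⟨h1, h2, h3, h4, h5, h6, h7, fun y => (h8 y).trans (hsub y)⟩, fun y => ?_⟩
  obtain ⟨_, z, hz, hlt⟩ := hα y
  refine ⟨z, hz, fun hzψ => ?_⟩
  have hle : closure {z | z ∈ Φ y ∧ g (y, z) < α y} ⊆ {z | g (y, z) ≤ α y} :=
    closure_minimal (fun z hz => hz.2.le) (isClosed_le (hgy y) continuous_const)
  exact absurd (hle (h8 y hzψ)) (not_le.2 hlt)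
end

section
/- Let (Z,ρ) be a metric space, Y a paracompact Hausdorff C-space, and Φ : Y → subsets of Z a lower semicontinuous set-valued mapping such that each Φ(y) is infinite and ρ-complete. Then Φ has two Michael pairs (φ₀,ψ₀) and (φ₁,ψ₁) such that ψ₀(y) ∩ ψ₁(y) = ∅ for every y ∈ Y. -/
open Set Topology Filter

structure GoodAtoms {Y Z : Type*} [TopologicalSpace Y] [TopologicalSpace Z]
    (Φ : Y → Set Z) (A : Set (Set Y × Set Z)) : Prop where
  openL : ∀ p ∈ A, IsOpen p.1
  openR : ∀ p ∈ A, IsOpen p.2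
  meets : ∀ p ∈ A, ∀ y ∈ closure p.1, (Φ y ∩ p.2).Nonempty
  locfin : ∀ y, ∃ N ∈ 𝓝 y, {p | p ∈ A ∧ (p.1 ∩ N).Nonempty}.Finite

lemma GoodAtoms.nbhd {Y Z : Type*} [TopologicalSpace Y] [TopologicalSpace Z]
    {Φ : Y → Set Z} {A : Set (Set Y × Set Z)} (h : GoodAtoms Φ A) (w : Y) :
    {p | p ∈ A ∧ w ∈ closure p.1}.Finite ∧
    ∃ N, IsOpen N ∧ w ∈ N ∧ ∀ p ∈ A, (closure p.1 ∩ N).Nonempty → w ∈ closure p.1 := by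
  obtain ⟨N, hN, hfin⟩ := h.locfin w
  refine ⟨hfin.subset ?_, ?_⟩
  · rintro p ⟨hp, hw⟩
    refine ⟨hp, ?_⟩
    have := mem_closure_iff_nhds.1 hw N hN
    rwa [inter_comm] at this
  · have hfin2 : ({p | p ∈ A ∧ (p.1 ∩ N).Nonempty} ∩ {p | w ∉ closure p.1}).Finite :=
      hfin.inter_of_left _
    refine ⟨interior N \ ⋃ p ∈ ({p | p ∈ A ∧ (p.1 ∩ N).Nonempty} ∩ {p | w ∉ closure p.1}),
      closure p.1, isOpen_interior.sdiff (hfin2.isClosed_biUnion fun _ _ => isClosed_closure),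
      ⟨mem_interior_iff_mem_nhds.2 hN, ?_⟩, ?_⟩
    · simp only [mem_iUnion, not_exists]
      intro p hp hw
      exact hp.2 hw
    · rintro p hp ⟨x, hx, hxN, hxU⟩
      by_contra hw
      apply hxU
      simp only [mem_iUnion]
      refine ⟨p, ⟨⟨hp, ?_⟩, hw⟩, hx⟩
      obtain ⟨t, ht, ht'⟩ := mem_closure_iff.1 hx _ isOpen_interior hxN
      exact ⟨t, ht', interior_subset ht⟩

lemma exists_fine_refinement {Y : Type*} [TopologicalSpace Y] [T2Space Y] [ParacompactSpace Y]
    {ι : Type*} (M : ι → Set Y) (hM : ∀ i, IsOpen (M i)) (hc : ⋃ i, M i = univ) :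
    ∃ W : ι → Set Y, (∀ i, IsOpen (W i)) ∧ (⋃ i, W i = univ) ∧ LocallyFinite W ∧
      ∀ i, closure (W i) ⊆ M i := by
  obtain ⟨v, hv, hvc, hvl, hvs⟩ := precise_refinement M hM hc
  obtain ⟨W, hWc, hWo, hWs⟩ := exists_iUnion_eq_closure_subset hv hvl.point_finite hvc
  exact ⟨W, hWo, hWc, hvl.subset fun i => subset_closure.trans (hWs i),
    fun i => (hWs i).trans (hvs i)⟩

lemma locfin_of_indexed {Y Z ι : Type*} [TopologicalSpace Y]
    (W : ι → Set Y) (hW : LocallyFinite W) (C : ι → Set (Set Y × Set Z))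
    (hC : ∀ i, (C i).Finite) (hCW : ∀ i, ∀ p ∈ C i, p.1 ⊆ W i) (y : Y) :
    ∃ N ∈ 𝓝 y, {p | p ∈ (⋃ i, C i) ∧ (p.1 ∩ N).Nonempty}.Finite := by
  obtain ⟨N, hN, hf⟩ := hW y
  refine ⟨N, hN, (hf.biUnion fun i _ => hC i).subset ?_⟩
  rintro p ⟨hp, hne⟩
  obtain ⟨i, hi⟩ := mem_iUnion.1 hp
  simp only [mem_iUnion]
  exact ⟨i, hne.mono (inter_subset_inter_left _ (hCW i p hi)), hi⟩

/-- One refinement step for the Michael theorem. -/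
lemma michael_step {Y Z : Type*} [TopologicalSpace Y] [T2Space Y] [ParacompactSpace Y]
    [MetricSpace Z] {Φ : Y → Set Z} (hlsc : IsLSCMap Φ) {A : Set (Set Y × Set Z)}
    (hA : GoodAtoms Φ A) {ε : ℝ} (hε : 0 < ε) :
    ∃ A' : Set (Set Y × Set Z), GoodAtoms Φ A' ∧
      (∀ p ∈ A', ∃ c, p.2 ⊆ Metric.ball c ε) ∧
      (∀ p ∈ A', ∃ q ∈ A, p.1 ⊆ q.1 ∧ p.2 ⊆ q.2) ∧
      (∀ q ∈ A, ∀ y ∈ q.1, ∃ p ∈ A', y ∈ p.1 ∧ p.1 ⊆ q.1 ∧ p.2 ⊆ q.2) := by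
  choose hT N hNo hwN hN using fun w => hA.nbhd w
  have hq : ∀ (w : Y) (p : Set Y × Set Z), ∃ b : Set Z, p ∈ A ∧ w ∈ closure p.1 →
      IsOpen b ∧ b ⊆ p.2 ∧ (Φ w ∩ b).Nonempty ∧ ∃ c, b ⊆ Metric.ball c ε := by
    intro w p
    by_cases h : p ∈ A ∧ w ∈ closure p.1
    · obtain ⟨q, hq1, hq2⟩ := hA.meets p h.1 w h.2
      exact ⟨p.2 ∩ Metric.ball q ε, fun _ => ⟨(hA.openR p h.1).inter Metric.isOpen_ball,
        inter_subset_left, ⟨q, hq1, hq2, Metric.mem_ball_self hε⟩, q, inter_subset_right⟩⟩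
    · exact ⟨∅, fun h' => absurd h' h⟩
  choose b hb using hq
  obtain ⟨W, hWo, hWc, hWl, hWs⟩ := exists_fine_refinement
    (fun w => N w ∩ ⋂ p ∈ {p | p ∈ A ∧ w ∈ closure p.1}, {y | (Φ y ∩ b w p).Nonempty})
    (fun w => (hNo w).inter ((hT w).isOpen_biInter fun p hp => hlsc _ (hb w p hp).1))
    (by
      refine eq_univ_of_forall fun w => mem_iUnion.2 ⟨w, hwN w, ?_⟩
      simp only [mem_iInter]
      intro p hp
      exact (hb w p hp).2.2.1)
  refine ⟨⋃ w, (fun p => (p.1 ∩ W w, b w p)) '' {p | p ∈ A ∧ w ∈ closure p.1},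
    ⟨?_, ?_, ?_, ?_⟩, ?_, ?_, ?_⟩
  · intro p' hp'
    obtain ⟨w, p, hp, rfl⟩ := mem_iUnion.1 hp'
    exact (hA.openL p hp.1).inter (hWo w)
  · intro p' hp'
    obtain ⟨w, p, hp, rfl⟩ := mem_iUnion.1 hp'
    exact (hb w p hp).1
  · intro p' hp' y hy
    obtain ⟨w, p, hp, rfl⟩ := mem_iUnion.1 hp'
    have := (hWs w (closure_mono inter_subset_right hy)).2
    simp only [mem_iInter] at this
    exact this p hp
  · refine locfin_of_indexed W hWl _ (fun w => (hT w).image _) ?_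
    rintro w _ ⟨p, hp, rfl⟩
    exact inter_subset_right
  · intro p' hp'
    obtain ⟨w, p, hp, rfl⟩ := mem_iUnion.1 hp'
    exact (hb w p hp).2.2.2
  · intro p' hp'
    obtain ⟨w, p, hp, rfl⟩ := mem_iUnion.1 hp'
    exact ⟨p, hp.1, inter_subset_left, (hb w p hp).2.1⟩
  · intro q hq y hy
    obtain ⟨w, hw⟩ := mem_iUnion.1 (hWc ▸ mem_univ y : y ∈ ⋃ w, W w)
    have hwq : w ∈ closure q.1 :=
      hN w q hq ⟨y, subset_closure hy, (hWs w (subset_closure hw)).1⟩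
    exact ⟨(q.1 ∩ W w, b w q), mem_iUnion.2 ⟨w, q, ⟨hq, hwq⟩, rfl⟩, ⟨hy, hw⟩, inter_subset_left,
      (hb w q ⟨hq, hwq⟩).2.1⟩

/-- Cantor-Kuratowski. -/
lemma kuratowski {X : Type*} [MetricSpace X] [CompleteSpace X] (K : ℕ → Set X)
    (hK : ∀ n, IsClosed (K n)) (hanti : Antitone K)
    (hsmall : ∀ ε > 0, ∃ n, ∃ T : Set X, T.Finite ∧ K n ⊆ ⋃ c ∈ T, Metric.ball c ε)
    (U : Set X) (hU : IsOpen U) (h : ⋂ n, K n ⊆ U) : ∃ n, K n ⊆ U := by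
  by_contra hcon
  push Not at hcon
  have hne : (⨅ n, 𝓟 (K n \ U)).NeBot := by
    apply iInf_neBot_of_directed'
    · intro i j
      refine ⟨max i j, ?_, ?_⟩ <;> simp only [ge_iff_le, le_principal_iff, mem_principal]
      · exact sdiff_subset_sdiff_left (hanti (le_max_left _ _))
      · exact sdiff_subset_sdiff_left (hanti (le_max_right _ _))
    · intro n
      rw [principal_neBot_iff]
      exact not_subset.1 (hcon n)
  let F := Ultrafilter.of (⨅ n, 𝓟 (K n \ U))
  have hF : ∀ n, K n \ U ∈ F := fun n =>
    Ultrafilter.of_le _ (mem_iInf_of_mem n (mem_principal_self _))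
  have hC : Cauchy (F : Filter X) := by
    rw [Metric.cauchy_iff]
    refine ⟨F.neBot, fun ε hε => ?_⟩
    obtain ⟨n, T, hT, hKT⟩ := hsmall (ε / 2) (half_pos hε)
    have : (⋃ c ∈ T, Metric.ball c (ε / 2)) ∈ F := mem_of_superset (hF n) (sdiff_subset.trans hKT)
    obtain ⟨c, hc, htF⟩ := (Ultrafilter.finite_biUnion_mem_iff hT).1 this
    refine ⟨_, htF, fun x hx y hy => ?_⟩
    have h1 := Metric.mem_ball.1 hx
    have h2 := Metric.mem_ball.1 hy
    have h3 := dist_triangle_right x y c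
    linarith
  obtain ⟨x, hx⟩ := CompleteSpace.complete hC
  have hx' : ∀ n, x ∈ K n \ U := fun n =>
    ((hK n).sdiff hU).mem_of_tendsto (b := (F : Filter X)) (f := id) hx (hF n)
  exact (hx' 0).2 (h (mem_iInter.2 fun n => (hx' n).1))

lemma michael_complete {Y Z : Type*} [TopologicalSpace Y] [T2Space Y] [ParacompactSpace Y]
    [MetricSpace Z] [CompleteSpace Z] (Φ : Y → Set Z) (hlsc : IsLSCMap Φ)
    (hne : ∀ y, (Φ y).Nonempty) (hcl : ∀ y, IsClosed (Φ y)) :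
    ∃ φ ψ : Y → Set Z, MichaelPair Φ φ ψ := by
  have h0 : GoodAtoms Φ {((univ : Set Y), (univ : Set Z))} := by
    refine ⟨?_, ?_, ?_, fun y => ⟨univ, univ_mem, ?_⟩⟩
    · rintro _ rfl; exact isOpen_univ
    · rintro _ rfl; exact isOpen_univ
    · rintro _ rfl y -; simpa using hne y
    · exact (finite_singleton _).subset fun p hp => hp.1
  have hstep : ∀ (n : ℕ) (A : {A : Set (Set Y × Set Z) // GoodAtoms Φ A}),
      ∃ A' : {A : Set (Set Y × Set Z) // GoodAtoms Φ A},
      (∀ p ∈ A'.1, ∃ c, p.2 ⊆ Metric.ball c (1 / ((n : ℝ) + 1))) ∧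
      (∀ p ∈ A'.1, ∃ q ∈ A.1, p.1 ⊆ q.1 ∧ p.2 ⊆ q.2) ∧
      (∀ q ∈ A.1, ∀ y ∈ q.1, ∃ p ∈ A'.1, y ∈ p.1 ∧ p.1 ⊆ q.1 ∧ p.2 ⊆ q.2) := by
    intro n A
    obtain ⟨A', h1, h2⟩ := michael_step hlsc A.2 (Nat.one_div_pos_of_nat (α := ℝ) (n := n))
    exact ⟨⟨A', h1⟩, h2⟩
  choose nxt hsm hpar hchild using hstep
  let A : ℕ → {A : Set (Set Y × Set Z) // GoodAtoms Φ A} :=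
    fun n => Nat.rec ⟨_, h0⟩ (fun n A => nxt n A) n
  have hA0 : (A 0).1 = {((univ : Set Y), (univ : Set Z))} := rfl
  have hAs : ∀ n, A (n + 1) = nxt n (A n) := fun n => rfl
  have hsm' : ∀ n, ∀ p ∈ (A (n + 1)).1, ∃ c, p.2 ⊆ Metric.ball c (1 / ((n : ℝ) + 1)) :=
    fun n => hsm n (A n)
  have hpar' : ∀ n, ∀ p ∈ (A (n + 1)).1, ∃ q ∈ (A n).1, p.1 ⊆ q.1 ∧ p.2 ⊆ q.2 :=
    fun n => hpar n (A n)
  have hchild' : ∀ n, ∀ q ∈ (A n).1, ∀ y ∈ q.1,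
      ∃ p ∈ (A (n + 1)).1, y ∈ p.1 ∧ p.1 ⊆ q.1 ∧ p.2 ⊆ q.2 := fun n => hchild n (A n)
  clear_value A
  let K : Y → ℕ → Set Z := fun y n => ⋃ p ∈ {p | p ∈ (A n).1 ∧ y ∈ closure p.1}, closure p.2
  let L : Y → ℕ → Set Z := fun y n => ⋃ p ∈ {p | p ∈ (A n).1 ∧ y ∈ p.1}, closure p.2
  have memK : ∀ y n z, z ∈ K y n ↔ ∃ p ∈ (A n).1, y ∈ closure p.1 ∧ z ∈ closure p.2 := by
    intro y n z; simp [K, and_assoc]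
  have memL : ∀ y n z, z ∈ L y n ↔ ∃ p ∈ (A n).1, y ∈ p.1 ∧ z ∈ closure p.2 := by
    intro y n z; simp [L, and_assoc]
  have hLK : ∀ y n, L y n ⊆ K y n := by
    intro y n z hz
    obtain ⟨p, hp, hy, hz⟩ := (memL _ _ _).1 hz
    exact (memK _ _ _).2 ⟨p, hp, subset_closure hy, hz⟩
  have hKcl : ∀ y n, IsClosed (K y n) := fun y n =>
    ((A n).2.nbhd y).1.isClosed_biUnion fun _ _ => isClosed_closure
  have hLcl : ∀ y n, IsClosed (L y n) := fun y n =>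
    (((A n).2.nbhd y).1.subset fun p hp => ⟨hp.1, subset_closure hp.2⟩).isClosed_biUnion
      fun _ _ => isClosed_closure
  have hKanti : ∀ y, Antitone (K y) := by
    intro y
    refine antitone_nat_of_succ_le fun n z hz => ?_
    obtain ⟨p, hp, hy, hz⟩ := (memK _ _ _).1 hz
    obtain ⟨q, hq, h1, h2⟩ := hpar' n p hp
    exact (memK _ _ _).2 ⟨q, hq, closure_mono h1 hy, closure_mono h2 hz⟩
  have hLanti : ∀ y, Antitone (L y) := by
    intro y
    refine antitone_nat_of_succ_le fun n z hz => ?_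
    obtain ⟨p, hp, hy, hz⟩ := (memL _ _ _).1 hz
    obtain ⟨q, hq, h1, h2⟩ := hpar' n p hp
    exact (memL _ _ _).2 ⟨q, hq, h1 hy, closure_mono h2 hz⟩
  have hball : ∀ ε > 0, ∃ n, ∀ p ∈ (A n).1, ∃ c, closure p.2 ⊆ Metric.ball c ε := by
    intro ε hε
    obtain ⟨n, hn⟩ := exists_nat_one_div_lt hε
    refine ⟨n + 1, fun p hp => ?_⟩
    obtain ⟨c, hc⟩ := hsm' n p hp
    exact ⟨c, ((closure_mono hc).trans Metric.closure_ball_subset_closedBall).trans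
      (Metric.closedBall_subset_ball hn)⟩
  have hKsmall : ∀ y, ∀ ε > 0, ∃ n, ∃ T : Set Z, T.Finite ∧
      K y n ⊆ ⋃ c ∈ T, Metric.ball c ε := by
    intro y ε hε
    obtain ⟨n, hn⟩ := hball ε hε
    have : Nonempty Z := ⟨(hne y).some⟩
    choose! c hc using hn
    refine ⟨n, c '' {p | p ∈ (A n).1 ∧ y ∈ closure p.1}, ((A n).2.nbhd y).1.image _, ?_⟩
    intro z hz
    obtain ⟨p, hp, hy, hz⟩ := (memK _ _ _).1 hz
    simp only [mem_iUnion]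
    exact ⟨c p, ⟨p, ⟨hp, hy⟩, rfl⟩, hc p hp hz⟩
  have hcomp : ∀ y, ∀ C : Set Z, IsClosed C → (∀ n, C ⊆ K y n) → IsCompact C := by
    intro y C hC hCK
    rw [isCompact_iff_totallyBounded_isComplete]
    refine ⟨Metric.totallyBounded_iff.2 fun ε hε => ?_, hC.isComplete⟩
    obtain ⟨n, T, hT, h⟩ := hKsmall y ε hε
    exact ⟨T, hT, (hCK n).trans h⟩
  have hbranch : ∀ n, ∀ p ∈ (A n).1, ∀ y ∈ p.1, ((⋂ m, L y m) ∩ closure p.2).Nonempty := by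
    intro n p hp y hy
    have hk : ∀ k, ∃ p' ∈ (A (n + k)).1, y ∈ p'.1 ∧ p'.2 ⊆ p.2 := by
      intro k
      induction k with
      | zero => exact ⟨p, hp, hy, subset_rfl⟩
      | succ k ih =>
        obtain ⟨p', hp', hy', hs⟩ := ih
        obtain ⟨p'', h1, h2, -, h4⟩ := hchild' (n + k) p' hp' y hy'
        exact ⟨p'', h1, h2, h4.trans hs⟩
    by_contra hemp
    rw [not_nonempty_iff_eq_empty] at hemp
    obtain ⟨m, hm⟩ := kuratowski (fun m => L y m ∩ closure p.2)
      (fun m => (hLcl y m).inter isClosed_closure)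
      (fun i j hij => inter_subset_inter_left _ (hLanti y hij))
      (fun ε hε => by
        obtain ⟨n, T, hT, h⟩ := hKsmall y ε hε
        exact ⟨n, T, hT, (inter_subset_left.trans (hLK y n)).trans h⟩) ∅ isOpen_empty
      (by rw [← hemp, iInter_inter])
    obtain ⟨p', hp', hy', hs⟩ := hk m
    obtain ⟨z, -, hz⟩ := (A (n + m)).2.meets p' hp' y (subset_closure hy')
    have : z ∈ L y (n + m) := (memL _ _ _).2 ⟨p', hp', hy', subset_closure hz⟩
    exact hm ⟨hLanti y (Nat.le_add_left m n) this, subset_closure (hs hz)⟩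
  have hφψ : ∀ y, (⋂ n, L y n) ⊆ ⋂ n, K y n := fun y => iInter_mono fun n => hLK y n
  have hφne : ∀ y, (⋂ n, L y n).Nonempty := fun y =>
    (hbranch 0 (univ, univ) (by rw [hA0]; rfl) y (mem_univ _)).mono inter_subset_left
  refine ⟨fun y => ⋂ n, L y n, fun y => ⋂ n, K y n, hφne, ?_, ?_,
    fun y => (hφne y).mono (hφψ y), ?_, ?_, hφψ, ?_⟩
  · intro y
    exact hcomp y _ (isClosed_iInter (hLcl y)) fun n => (hφψ y).trans (iInter_subset _ n)
  · intro V hV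
    rw [isOpen_iff_mem_nhds]
    rintro y ⟨z, hz, hzV⟩
    obtain ⟨ε, hε, hεV⟩ := Metric.isOpen_iff.1 hV z hzV
    obtain ⟨n, hn⟩ := hball (ε / 2) (half_pos hε)
    obtain ⟨p, hp, hy, hzp⟩ := (memL _ _ _).1 (mem_iInter.1 hz n)
    obtain ⟨c, hc⟩ := hn p hp
    filter_upwards [((A n).2.openL p hp).mem_nhds hy] with y' hy'
    obtain ⟨z', hz', hzp'⟩ := hbranch n p hp y' hy'
    refine ⟨z', hz', hεV ?_⟩
    have h1 := Metric.mem_ball.1 (hc hzp)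
    have h2 := Metric.mem_ball.1 (hc hzp')
    have h3 := dist_triangle_right z' z c
    rw [Metric.mem_ball]
    linarith
  · intro y
    exact hcomp y _ (isClosed_iInter (hKcl y)) fun n => iInter_subset _ n
  · intro V hV
    rw [isOpen_iff_mem_nhds]
    intro y hy
    obtain ⟨n, hn⟩ := kuratowski (K y) (hKcl y) (hKanti y) (hKsmall y) V hV hy
    obtain ⟨N, hNo, hyN, hN⟩ := ((A n).2.nbhd y).2
    filter_upwards [hNo.mem_nhds hyN] with y' hy'
    refine (iInter_subset _ n).trans (Subset.trans ?_ hn)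
    intro z hz
    obtain ⟨p, hp, hyp, hzp⟩ := (memK _ _ _).1 hz
    exact (memK _ _ _).2 ⟨p, hp, hN p hp ⟨y', hyp, hy'⟩, hzp⟩
  · intro y z hz
    rw [← (hcl y).closure_eq, Metric.mem_closure_iff]
    intro ε hε
    obtain ⟨n, hn⟩ := hball (ε / 2) (half_pos hε)
    obtain ⟨p, hp, hy, hzp⟩ := (memK _ _ _).1 (mem_iInter.1 hz n)
    obtain ⟨c, hc⟩ := hn p hp
    obtain ⟨x, hx, hxp⟩ := (A n).2.meets p hp y hy
    refine ⟨x, hx, ?_⟩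
    have h1 := Metric.mem_ball.1 (hc hzp)
    have h2 := Metric.mem_ball.1 (hc (subset_closure hxp))
    have h3 := dist_triangle_right z x c
    linarith

lemma michael {Y Z : Type*} [TopologicalSpace Y] [T2Space Y] [ParacompactSpace Y]
    [MetricSpace Z] (Φ : Y → Set Z) (hlsc : IsLSCMap Φ)
    (hne : ∀ y, (Φ y).Nonempty) (hcl : ∀ y, IsComplete (Φ y)) :
    ∃ φ ψ : Y → Set Z, MichaelPair Φ φ ψ := by
  let e : Z → UniformSpace.Completion Z := fun z => (z : UniformSpace.Completion Z)
  have he : IsUniformInducing e := UniformSpace.Completion.isUniformInducing_coe Z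
  have hinj : Function.Injective e := UniformSpace.Completion.coe_injective Z
  obtain ⟨φ, ψ, h1, h2, h3, h4, h5, h6, h7, h8⟩ := michael_complete (fun y => e '' Φ y)
    (by
      intro U hU
      have := hlsc (e ⁻¹' U) (hU.preimage he.isInducing.continuous)
      convert this using 3 with y
      constructor
      · rintro ⟨_, ⟨z, hz, rfl⟩, hzU⟩; exact ⟨z, hz, hzU⟩
      · rintro ⟨z, hz, hzU⟩; exact ⟨e z, ⟨z, hz, rfl⟩, hzU⟩)
    (fun y => (hne y).image e) (fun y => ((isComplete_image_iff he).2 (hcl y)).isClosed)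
  have hψr : ∀ y, ∀ x ∈ ψ y, ∃ z ∈ Φ y, e z = x := fun y x hx => h8 y hx
  refine ⟨fun y => e ⁻¹' φ y, fun y => e ⁻¹' ψ y, ?_, ?_, ?_, ?_, ?_, ?_, ?_, ?_⟩
  · intro y
    obtain ⟨x, hx⟩ := h1 y
    obtain ⟨z, -, rfl⟩ := hψr y x (h7 y hx)
    exact ⟨z, hx⟩
  · intro y
    refine (he.isInducing.isCompact_preimage_iff ?_).2 (h2 y)
    intro x hx
    obtain ⟨z, -, rfl⟩ := hψr y x (h7 y hx)
    exact ⟨z, rfl⟩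
  · intro U hU
    obtain ⟨V, hV, rfl⟩ := he.isInducing.isOpen_iff.1 hU
    convert h3 V hV using 3 with y
    constructor
    · rintro ⟨z, hz, hzV⟩; exact ⟨e z, hz, hzV⟩
    · rintro ⟨x, hx, hxV⟩
      obtain ⟨z, -, rfl⟩ := hψr y x (h7 y hx)
      exact ⟨z, hx, hxV⟩
  · intro y
    obtain ⟨x, hx⟩ := h4 y
    obtain ⟨z, -, rfl⟩ := hψr y x hx
    exact ⟨z, hx⟩
  · intro y
    refine (he.isInducing.isCompact_preimage_iff ?_).2 (h5 y)
    intro x hx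
    obtain ⟨z, -, rfl⟩ := hψr y x hx
    exact ⟨z, rfl⟩
  · intro U hU
    obtain ⟨V, hV, rfl⟩ := he.isInducing.isOpen_iff.1 hU
    convert h6 V hV using 3 with y
    constructor
    · intro h x hx
      obtain ⟨z, -, rfl⟩ := hψr y x hx
      exact h hx
    · intro h z hz
      exact h hz
  · intro y
    exact preimage_mono (h7 y)
  · intro y z hz
    obtain ⟨z', hz', h⟩ := hψr y _ hz
    exact hinj h ▸ hz'

lemma exists_fresh {Z : Type*} [MetricSpace Z] {P : Set Z} (hP : P.Infinite) {Q : Set Z}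
    (hQ : Q.Finite) : ∃ (S : Set Z) (B : Bool → Set Z), IsOpen S ∧ (∀ i, IsOpen (B i)) ∧
      Q ⊆ S ∧ (∀ i, (P ∩ B i).Nonempty) ∧ (∀ i, Disjoint (closure S) (closure (B i))) ∧
      Disjoint (closure (B false)) (closure (B true)) := by
  obtain ⟨b0, hb0, hb0Q⟩ := (hP.sdiff hQ).nonempty
  obtain ⟨b1, hb1, hb1Q⟩ := (hP.sdiff (hQ.insert b0)).nonempty
  simp only [mem_insert_iff, not_or] at hb1Q
  obtain ⟨S, hS, hQS, hS'⟩ := normal_exists_closure_subset hQ.isClosed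
    ((finite_singleton b0).insert b1).isClosed.isOpen_compl (by
      rintro q hq (rfl | rfl)
      · exact hb1Q.2 hq
      · exact hb0Q hq)
  obtain ⟨B0, hB0, hbB0, hB0'⟩ := normal_exists_closure_subset (isClosed_singleton (x := b0))
    ((isClosed_closure (s := S)).union (isClosed_singleton (x := b1))).isOpen_compl (by
      rintro q rfl (h | h)
      · exact hS' h (Or.inr rfl)
      · exact hb1Q.1 h.symm)
  obtain ⟨B1, hB1, hbB1, hB1'⟩ := normal_exists_closure_subset (isClosed_singleton (x := b1))
    ((isClosed_closure (s := S)).union (isClosed_closure (s := B0))).isOpen_compl (by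
      rintro q rfl (h | h)
      · exact hS' h (Or.inl rfl)
      · exact hB0' h (Or.inr rfl))
  refine ⟨S, fun i => bif i then B1 else B0, hS, ?_, hQS, ?_, ?_, ?_⟩
  · rintro (_ | _) <;> assumption
  · rintro (_ | _)
    · exact ⟨b0, hb0, hbB0 rfl⟩
    · exact ⟨b1, hb1, hbB1 rfl⟩
  · rintro (_ | _)
    · exact disjoint_left.2 fun x hx hx' => hB0' hx' (Or.inl hx)
    · exact disjoint_left.2 fun x hx hx' => hB1' hx' (Or.inl hx)
  · exact disjoint_left.2 fun x hx hx' => hB1' hx' (Or.inr hx)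

lemma double_step {Y Z : Type*} [TopologicalSpace Y] [T2Space Y] [ParacompactSpace Y]
    [MetricSpace Z] {Φ : Y → Set Z} (hlsc : IsLSCMap Φ) (hinf : ∀ y, (Φ y).Infinite)
    {A : Set (Set Y × Set Z)} (hA : GoodAtoms Φ A) :
    ∃ (W : Y → Set Y) (S : Y → Set Z) (B : Bool → Y → Set Z) (A' : Set (Set Y × Set Z)),
      GoodAtoms Φ A' ∧ (∀ w, IsOpen (W w)) ∧ (⋃ w, W w = univ) ∧ (∀ w, IsOpen (S w)) ∧
      (∀ i w, IsOpen (B i w)) ∧ (∀ i w, Disjoint (closure (S w)) (closure (B i w))) ∧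
      (∀ w, Disjoint (closure (B false w)) (closure (B true w))) ∧ A ⊆ A' ∧
      (∀ p ∈ A, ∀ w, ∀ y ∈ p.1, y ∈ W w → (p.1 ∩ W w, p.2 ∩ S w) ∈ A') ∧
      (∀ i w, (W w, B i w) ∈ A') := by
  choose hT N hNo hwN hN using fun w => hA.nbhd w
  have hq : ∀ (w : Y) (p : Set Y × Set Z), ∃ q : Z, p ∈ A ∧ w ∈ closure p.1 → q ∈ Φ w ∩ p.2 := by
    intro w p
    by_cases h : p ∈ A ∧ w ∈ closure p.1
    · obtain ⟨q, hq⟩ := hA.meets p h.1 w h.2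
      exact ⟨q, fun _ => hq⟩
    · exact ⟨(hinf w).nonempty.some, fun h' => absurd h' h⟩
  choose q hq using hq
  choose S B hS hB hQS hPB hSB hBB using fun w => exists_fresh (hinf w) ((hT w).image (q w))
  obtain ⟨W, hWo, hWc, hWl, hWs⟩ := exists_fine_refinement
    (fun w => (N w ∩ ⋂ p ∈ {p | p ∈ A ∧ w ∈ closure p.1}, {y | (Φ y ∩ (p.2 ∩ S w)).Nonempty}) ∩
      ⋂ i, {y | (Φ y ∩ B w i).Nonempty})
    (fun w => ((hNo w).inter ((hT w).isOpen_biInter fun p hp =>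
      hlsc _ ((hA.openR p hp.1).inter (hS w)))).inter
        (isOpen_iInter_of_finite fun i => hlsc _ (hB w i)))
    (by
      refine eq_univ_of_forall fun w => mem_iUnion.2 ⟨w, ⟨hwN w, ?_⟩, ?_⟩
      · simp only [mem_iInter]
        intro p hp
        exact ⟨q w p, (hq w p hp).1, (hq w p hp).2, hQS w ⟨p, hp, rfl⟩⟩
      · exact mem_iInter.2 fun i => hPB w i)
  have hmeetS : ∀ w, ∀ y ∈ closure (W w), ∀ p ∈ A, w ∈ closure p.1 →
      (Φ y ∩ (p.2 ∩ S w)).Nonempty := by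
    intro w y hy p hp hwp
    have := (hWs w hy).1.2
    simp only [mem_iInter] at this
    exact this p ⟨hp, hwp⟩
  have hmeetB : ∀ w, ∀ y ∈ closure (W w), ∀ i, (Φ y ∩ B w i).Nonempty :=
    fun w y hy i => mem_iInter.1 (hWs w hy).2 i
  let C : Y → Set (Set Y × Set Z) := fun w =>
    (fun p => (p.1 ∩ W w, p.2 ∩ S w)) '' {p | p ∈ A ∧ w ∈ closure p.1} ∪
      range fun i => (W w, B w i)
  refine ⟨W, S, fun i w => B w i, A ∪ ⋃ w, C w, ⟨?_, ?_, ?_, ?_⟩, hWo, hWc, hS,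
    fun i w => hB w i, fun i w => hSB w i, hBB, subset_union_left, ?_, ?_⟩
  · rintro p' (hp' | hp')
    · exact hA.openL p' hp'
    obtain ⟨w, ⟨p, hp, rfl⟩ | ⟨i, rfl⟩⟩ := mem_iUnion.1 hp'
    · exact (hA.openL p hp.1).inter (hWo w)
    · exact hWo w
  · rintro p' (hp' | hp')
    · exact hA.openR p' hp'
    obtain ⟨w, ⟨p, hp, rfl⟩ | ⟨i, rfl⟩⟩ := mem_iUnion.1 hp'
    · exact (hA.openR p hp.1).inter (hS w)
    · exact hB w i
  · rintro p' (hp' | hp') y hy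
    · exact hA.meets p' hp' y hy
    obtain ⟨w, ⟨p, hp, rfl⟩ | ⟨i, rfl⟩⟩ := mem_iUnion.1 hp'
    · exact hmeetS w y (closure_mono inter_subset_right hy) p hp.1 hp.2
    · exact hmeetB w y hy i
  · intro y
    obtain ⟨N1, hN1, hf1⟩ := hA.locfin y
    obtain ⟨N2, hN2, hf2⟩ := locfin_of_indexed W hWl C
      (fun w => ((hT w).image _).union (finite_range _)) (by
        rintro w _ (⟨p, hp, rfl⟩ | ⟨i, rfl⟩)
        · exact inter_subset_right
        · exact subset_rfl) y
    refine ⟨N1 ∩ N2, inter_mem hN1 hN2, (hf1.union hf2).subset ?_⟩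
    rintro p ⟨hp | hp, hne⟩
    · exact Or.inl ⟨hp, hne.mono (inter_subset_inter_right _ inter_subset_left)⟩
    · exact Or.inr ⟨hp, hne.mono (inter_subset_inter_right _ inter_subset_right)⟩
  · intro p hp w y hy hyW
    have hwp : w ∈ closure p.1 :=
      hN w p hp ⟨y, subset_closure hy, (hWs w (subset_closure hyW)).1.1⟩
    exact Or.inr (mem_iUnion.2 ⟨w, Or.inl ⟨p, ⟨hp, hwp⟩, rfl⟩⟩)
  · intro i w
    exact Or.inr (mem_iUnion.2 ⟨w, Or.inr ⟨i, rfl⟩⟩)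

lemma cspace_indexed {Y : Type*} [TopologicalSpace Y] [T2Space Y] [ParacompactSpace Y]
    (hY : IsCSpace Y) {ι : Type*} (W : ℕ → ι → Set Y) (hW : ∀ n i, IsOpen (W n i))
    (hWc : ∀ n, ⋃ i, W n i = univ) :
    ∃ (E : ℕ → ι → Set Y) (O : ℕ → Set Y), (∀ n i, IsOpen (E n i)) ∧
      (∀ n i, E n i ⊆ W n i) ∧ (∀ n i j y, y ∈ E n i → y ∈ E n j → i = j) ∧
      LocallyFinite (fun n => ⋃ i, E n i) ∧ (∀ n, IsOpen (O n)) ∧ (⋃ n, O n = univ) ∧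
      ∀ n, closure (O n) ⊆ ⋃ i, E n i := by
  obtain ⟨V, hV, hVc⟩ := hY (fun n => range (W n)) (fun n => ⟨by
    rintro _ ⟨i, rfl⟩; exact hW n i, by rw [sUnion_range]; exact hWc n⟩)
  have hidx : ∀ (n : ℕ) (U : V n), ∃ i, U.1 ⊆ W n i := by
    intro n U
    obtain ⟨_, ⟨i, rfl⟩, h⟩ := (hV n).2.2 U.1 U.2
    exact ⟨i, h⟩
  choose ix hix using hidx
  let E : ℕ → ι → Set Y := fun n i => ⋃ U : {U : V n // ix n U = i}, U.1.1
  have hE : ∀ n i, IsOpen (E n i) := fun n i => isOpen_iUnion fun U => (hV n).1 _ U.1.2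
  obtain ⟨O1, hO1, hO1c, hO1l, hO1s⟩ := exists_fine_refinement (fun n => ⋃ i, E n i)
    (fun n => isOpen_iUnion (hE n)) (by
      refine eq_univ_of_forall fun y => ?_
      obtain ⟨U, hU, hyU⟩ : y ∈ ⋃₀ (⋃ n, V n) := hVc ▸ mem_univ y
      obtain ⟨n, hn⟩ := mem_iUnion.1 hU
      exact mem_iUnion.2 ⟨n, mem_iUnion.2 ⟨ix n ⟨U, hn⟩, mem_iUnion.2 ⟨⟨⟨U, hn⟩, rfl⟩, hyU⟩⟩⟩)
  obtain ⟨O, hO, hOc, -, hOs⟩ := exists_fine_refinement O1 hO1 hO1c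
  refine ⟨fun n i => E n i ∩ O1 n, O, fun n i => (hE n i).inter (hO1 n), ?_, ?_, ?_, hO, hOc, ?_⟩
  · rintro n i y ⟨hy, -⟩
    obtain ⟨⟨U, rfl⟩, hU⟩ := mem_iUnion.1 hy
    exact hix n U hU
  · rintro n i j y ⟨hyi, -⟩ ⟨hyj, -⟩
    obtain ⟨⟨U, rfl⟩, hU⟩ := mem_iUnion.1 hyi
    obtain ⟨⟨U', rfl⟩, hU'⟩ := mem_iUnion.1 hyj
    have : U = U' := by
      by_contra hne
      exact disjoint_left.1 ((hV n).2.1 U.2 U'.2 fun h => hne (Subtype.ext h)) hU hU'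
    rw [this]
  · exact hO1l.subset fun n => iUnion_subset fun i => inter_subset_right
  · intro n y hy
    have h1 := hOs n hy
    obtain ⟨i, hi⟩ := mem_iUnion.1 (hO1s n (subset_closure h1))
    exact mem_iUnion.2 ⟨i, hi, h1⟩

lemma exists_separation {Y Z : Type*} [TopologicalSpace Y] [T2Space Y] [ParacompactSpace Y]
    (hY : IsCSpace Y) [MetricSpace Z] (Φ : Y → Set Z) (hlsc : IsLSCMap Φ)
    (hinf : ∀ y, (Φ y).Infinite) :
    ∃ Γ : Bool → Y → Set Z, (∀ i, IsOpen {x : Y × Z | x.2 ∈ Γ i x.1}) ∧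
      (∀ i y, (Φ y ∩ Γ i y).Nonempty) ∧
      ∀ y, Disjoint (closure (Γ false y)) (closure (Γ true y)) := by
  have h0 : GoodAtoms Φ (∅ : Set (Set Y × Set Z)) :=
    ⟨fun p hp => hp.elim, fun p hp => hp.elim, fun p hp => hp.elim,
      fun y => ⟨univ, univ_mem, finite_empty.subset fun p hp => hp.1⟩⟩
  have hstep : ∀ A : {A : Set (Set Y × Set Z) // GoodAtoms Φ A},
      ∃ (A' : {A : Set (Set Y × Set Z) // GoodAtoms Φ A})
        (W : Y → Set Y) (S : Y → Set Z) (B : Bool → Y → Set Z),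
      (∀ w, IsOpen (W w)) ∧ (⋃ w, W w = univ) ∧ (∀ w, IsOpen (S w)) ∧
      (∀ i w, IsOpen (B i w)) ∧ (∀ i w, Disjoint (closure (S w)) (closure (B i w))) ∧
      (∀ w, Disjoint (closure (B false w)) (closure (B true w))) ∧ A.1 ⊆ A'.1 ∧
      (∀ p ∈ A.1, ∀ w, ∀ y ∈ p.1, y ∈ W w → (p.1 ∩ W w, p.2 ∩ S w) ∈ A'.1) ∧
      (∀ i w, (W w, B i w) ∈ A'.1) := by
    intro A
    obtain ⟨W, S, B, A', hA', h⟩ := double_step hlsc hinf A.2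
    exact ⟨⟨A', hA'⟩, W, S, B, h⟩
  choose nxt W' S' B' h1 h2 h3 h4 h5 h6 h7 h8 h9 using hstep
  let A : ℕ → {A : Set (Set Y × Set Z) // GoodAtoms Φ A} :=
    fun n => Nat.rec ⟨_, h0⟩ (fun _ A => nxt A) n
  have hAs : ∀ n, A (n + 1) = nxt (A n) := fun n => rfl
  clear_value A
  obtain ⟨E, O, hE, hEW, hEu, hEl, hO, hOc, hOE⟩ := cspace_indexed hY (fun n => W' (A n))
    (fun n => h1 (A n)) (fun n => h2 (A n))
  let G : ℕ → Bool → Y → Set Z := fun n => Nat.rec (fun _ _ => ∅) (fun n g i y =>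
    {z | (y ∉ closure (O n) ∧ z ∈ g i y) ∨
      ∃ w, y ∈ E n w ∧ ((z ∈ g i y ∧ z ∈ S' (A n) w) ∨ (y ∈ O n ∧ z ∈ B' (A n) i w))}) n
  have hG0 : ∀ i y, G 0 i y = ∅ := fun i y => rfl
  have hGs : ∀ n i y z, z ∈ G (n + 1) i y ↔ (y ∉ closure (O n) ∧ z ∈ G n i y) ∨
      ∃ w, y ∈ E n w ∧ ((z ∈ G n i y ∧ z ∈ S' (A n) w) ∨ (y ∈ O n ∧ z ∈ B' (A n) i w)) :=
    fun n i y z => Iff.rfl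
  clear_value G
  -- open graphs
  have hopen : ∀ n i, IsOpen {x : Y × Z | x.2 ∈ G n i x.1} := by
    intro n i
    induction n with
    | zero => simp [hG0]
    | succ n ih =>
      have heq : {x : Y × Z | x.2 ∈ G (n + 1) i x.1} =
          (Prod.fst ⁻¹' (closure (O n))ᶜ ∩ {x : Y × Z | x.2 ∈ G n i x.1}) ∪
          ⋃ w, (Prod.fst ⁻¹' (E n w) ∩
            (({x : Y × Z | x.2 ∈ G n i x.1} ∩ Prod.snd ⁻¹' (S' (A n) w)) ∪
              (Prod.fst ⁻¹' (O n) ∩ Prod.snd ⁻¹' (B' (A n) i w)))) := by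
        ext x
        simp [hGs]
      rw [heq]
      refine ((isClosed_closure.isOpen_compl.preimage continuous_fst).inter ih).union
        (isOpen_iUnion fun w => ((hE n w).preimage continuous_fst).inter
          ((ih.inter ((h3 (A n) w).preimage continuous_snd)).union
            (((hO n).preimage continuous_fst).inter ((h4 (A n) i w).preimage continuous_snd))))
  -- disjointness
  have hdisj : ∀ n y, Disjoint (closure (G n false y)) (closure (G n true y)) := by
    intro n y
    induction n with
    | zero => simp [hG0]
    | succ n ih =>
      by_cases hy : y ∈ closure (O n)
      · obtain ⟨w, hw⟩ := mem_iUnion.1 (hOE n hy)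
        have hsub : ∀ i, closure (G (n + 1) i y) ⊆
            (closure (G n i y) ∩ closure (S' (A n) w)) ∪ closure (B' (A n) i w) := by
          intro i
          refine closure_minimal ?_ ((isClosed_closure.inter isClosed_closure).union
            isClosed_closure)
          intro z hz
          rcases (hGs n i y z).1 hz with ⟨h, -⟩ | ⟨w', hw', h⟩
          · exact absurd hy h
          · obtain rfl := hEu n w w' y hw hw'
            rcases h with ⟨h, h'⟩ | ⟨-, h⟩
            · exact Or.inl ⟨subset_closure h, subset_closure h'⟩
            · exact Or.inr (subset_closure h)
        refine Disjoint.mono (hsub false) (hsub true) (disjoint_left.2 ?_)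
        rintro z (⟨ha, hb⟩ | hb) (⟨hc, hd⟩ | hd)
        · exact disjoint_left.1 ih ha hc
        · exact disjoint_left.1 (h5 (A n) true w) hb hd
        · exact disjoint_left.1 (h5 (A n) false w) hd hb
        · exact disjoint_left.1 (h6 (A n) w) hb hd
      · have hsub : ∀ i, G (n + 1) i y ⊆ G n i y := by
          intro i z hz
          rcases (hGs n i y z).1 hz with ⟨-, h⟩ | ⟨w', hw', ⟨h, -⟩ | ⟨h, -⟩⟩
          · exact h
          · exact h
          · exact absurd (subset_closure h) hy
        exact ih.mono (closure_mono (hsub false)) (closure_mono (hsub true))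
  -- atoms
  have hatom : ∀ n i y, (∃ k < n, y ∈ O k) → ∃ p ∈ (A n).1, y ∈ p.1 ∧ p.2 ⊆ G n i y := by
    intro n i y
    induction n with
    | zero => rintro ⟨k, hk, -⟩; omega
    | succ n ih =>
      rintro ⟨k, hk, hyk⟩
      rw [hAs]
      by_cases hyO : y ∈ O n
      · obtain ⟨w, hw⟩ := mem_iUnion.1 (hOE n (subset_closure hyO))
        exact ⟨_, h9 (A n) i w, hEW n w hw,
          fun z hz => (hGs n i y z).2 (Or.inr ⟨w, hw, Or.inr ⟨hyO, hz⟩⟩)⟩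
      · have hkn : k < n := by
          rcases Nat.lt_succ_iff_lt_or_eq.1 hk with h | rfl
          · exact h
          · exact absurd hyk hyO
        obtain ⟨p, hp, hyp, hpG⟩ := ih ⟨k, hkn, hyk⟩
        by_cases hy : y ∈ closure (O n)
        · obtain ⟨w, hw⟩ := mem_iUnion.1 (hOE n hy)
          exact ⟨_, h8 (A n) p hp w y hyp (hEW n w hw), ⟨hyp, hEW n w hw⟩,
            fun z hz => (hGs n i y z).2 (Or.inr ⟨w, hw, Or.inl ⟨hpG hz.1, hz.2⟩⟩)⟩
        · exact ⟨p, h7 (A n) hp, hyp, fun z hz => (hGs n i y z).2 (Or.inl ⟨hy, hpG hz⟩)⟩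
  -- local stability
  have hstab : ∀ y, ∃ N ∈ 𝓝 y, ∃ m, ∀ n ≥ m, ∀ y' ∈ N, ∀ i, G n i y' = G m i y' := by
    intro y
    obtain ⟨N, hN, hf⟩ := hEl y
    obtain ⟨m, hm⟩ := hf.bddAbove
    refine ⟨N, hN, m + 1, fun n hn y' hy' i => ?_⟩
    induction n, hn using Nat.le_induction with
    | base => rfl
    | succ n hn ih =>
      rw [← ih]
      have hnE : y' ∉ ⋃ w, E n w := by
        intro h
        have : n ≤ m := hm ⟨y', h, hy'⟩
        omega
      ext z
      rw [hGs]
      constructor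
      · rintro (⟨-, h⟩ | ⟨w, hw, -⟩)
        · exact h
        · exact absurd (mem_iUnion.2 ⟨w, hw⟩) hnE
      · intro h
        exact Or.inl ⟨fun h' => hnE (hOE n h'), h⟩
  choose N hN m hm using hstab
  have hΓ : ∀ y, ∀ y' ∈ N y, ∀ i, G (m y') i y' = G (m y) i y' := by
    intro y y' hy' i
    rw [← hm y (max (m y) (m y')) (le_max_left _ _) y' hy' i,
      ← hm y' (max (m y) (m y')) (le_max_right _ _) y' (mem_of_mem_nhds (hN y')) i]
  refine ⟨fun i y => G (m y) i y, ?_, ?_, fun y => hdisj (m y) y⟩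
  · intro i
    rw [isOpen_iff_mem_nhds]
    rintro ⟨y, z⟩ hz
    have hN' : Prod.fst ⁻¹' (N y) ∈ 𝓝 (y, z) := continuous_fst.continuousAt.preimage_mem_nhds (hN y)
    filter_upwards [(hopen (m y) i).mem_nhds hz, hN'] with x hx hxN
    rw [hΓ y x.1 hxN i]
    exact hx
  · intro i y
    obtain ⟨k, hk⟩ := mem_iUnion.1 (hOc ▸ mem_univ y : y ∈ ⋃ n, O n)
    obtain ⟨p, hp, hyp, hpG⟩ := hatom (max (m y) (k + 1)) i y ⟨k, by omega, hk⟩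
    rw [hm y _ (le_max_left _ _) y (mem_of_mem_nhds (hN y)) i] at hpG
    exact ((A _).2.meets p hp y (subset_closure hyp)).mono (inter_subset_inter_right _ hpG)

lemma michael_restrict {Y Z : Type*} [TopologicalSpace Y] [T2Space Y] [ParacompactSpace Y]
    [MetricSpace Z] (Φ : Y → Set Z) (hlsc : IsLSCMap Φ) (hcompl : ∀ y, IsComplete (Φ y))
    (Γ : Y → Set Z) (hΓ : IsOpen {x : Y × Z | x.2 ∈ Γ x.1}) (hne : ∀ y, (Φ y ∩ Γ y).Nonempty) :
    ∃ φ ψ : Y → Set Z, MichaelPair Φ φ ψ ∧ ∀ y, ψ y ⊆ closure (Γ y) := by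
  have hsub : ∀ y, closure (Φ y ∩ Γ y) ⊆ Φ y := fun y =>
    closure_minimal inter_subset_left (hcompl y).isClosed
  obtain ⟨φ, ψ, a1, a2, a3, a4, a5, a6, a7, a8⟩ := michael (fun y => closure (Φ y ∩ Γ y))
    (by
      intro U hU
      rw [isOpen_iff_mem_nhds]
      rintro y ⟨x, hx, hxU⟩
      obtain ⟨z, hzU, hzΦ, hzΓ⟩ := mem_closure_iff.1 hx U hU hxU
      obtain ⟨u, v, hu, hv, hyu, hzv, huv⟩ := isOpen_prod_iff.1 hΓ y z hzΓ
      filter_upwards [hu.mem_nhds hyu,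
        (hlsc (U ∩ v) (hU.inter hv)).mem_nhds ⟨z, hzΦ, hzU, hzv⟩] with y' hy' hy''
      obtain ⟨z', hz', hz'U, hz'v⟩ := hy''
      exact ⟨z', subset_closure ⟨hz', huv (mk_mem_prod hy' hz'v)⟩, hz'U⟩)
    (fun y => (hne y).closure)
    (fun y f hf hle => by
      obtain ⟨x, -, hx⟩ := hcompl y f hf (hle.trans (principal_mono.2 (hsub y)))
      have := hf.1
      exact ⟨x, isClosed_closure.mem_of_tendsto (b := f) (f := id) hx (le_principal_iff.1 hle), hx⟩)
  exact ⟨φ, ψ, ⟨a1, a2, a3, a4, a5, a6, a7, fun y => (a8 y).trans (hsub y)⟩,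
    fun y => (a8 y).trans (closure_mono inter_subset_right)⟩

theorem statement8 {Y Z : Type*} [TopologicalSpace Y] [T2Space Y] [ParacompactSpace Y]
    (hY : IsCSpace Y) [MetricSpace Z]
    (Φ : Y → Set Z) (hΦlsc : IsLSCMap Φ)
    (hinf : ∀ y, (Φ y).Infinite) (hcompl : ∀ y, IsComplete (Φ y)) :
    ∃ φ₀ ψ₀ φ₁ ψ₁ : Y → Set Z, MichaelPair Φ φ₀ ψ₀ ∧ MichaelPair Φ φ₁ ψ₁ ∧
      ∀ y, ψ₀ y ∩ ψ₁ y = ∅ := by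
  obtain ⟨Γ, hΓ, hne, hd⟩ := exists_separation hY Φ hΦlsc hinf
  obtain ⟨φ₀, ψ₀, h0, h0'⟩ := michael_restrict Φ hΦlsc hcompl (Γ false) (hΓ false) (hne false)
  obtain ⟨φ₁, ψ₁, h1, h1'⟩ := michael_restrict Φ hΦlsc hcompl (Γ true) (hΓ true) (hne true)
  exact ⟨φ₀, ψ₀, φ₁, ψ₁, h0, h1,
    fun y => disjoint_iff_inter_eq_empty.1 ((hd y).mono (h0' y) (h1' y))⟩
end
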